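/- arXiv:1904.04071 — 2 statements merged into one kernel-verified Lean document; each statement's English description precedes it below -/
import Mathlib

section
/- Let q = 2^n and let B be a k-subset of GF(q) with k ≥ 3. Suppose that f̂_B(μ) = Σ_{x ∈ GF(q)} (−1)^{Tr(x^t + μ^d x)} for all μ ∈ GF(q), where t and d are positive integers with gcd(td, q−1) = 1. Then (GF(q), GA₁(q)(B)) is a 3-design if and only if the number of x ∈ GF(q) satisfying (u^d x + (1+u)^d)^t + x^t + 1 = 0 is independent of u, for u ranging over GF(q) ∖ GF(2). -/
open Finset

noncomputable instance (n : ℕ) : Fintype (GaloisField 2 n) := Fintype.ofFinite _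

/-- The absolute trace map from `GF(2^n)` to `GF(2)`. -/
noncomputable def Tr (n : ℕ) (x : GaloisField 2 n) : ZMod 2 :=
  Algebra.trace (ZMod 2) (GaloisField 2 n) x

/-- The characteristic function of a subset `B ⊆ GF(2^n)`. -/
noncomputable def charFun {n : ℕ} (B : Set (GaloisField 2 n)) (x : GaloisField 2 n) : ZMod 2 :=
  open scoped Classical in if x ∈ B then 1 else 0

/-- The Walsh transform of a Boolean function on `GF(2^n)`, as an integer. -/
noncomputable def walsh {n : ℕ} (f : GaloisField 2 n → ZMod 2) (μ : GaloisField 2 n) : ℤ :=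
  ∑ x : GaloisField 2 n, (-1 : ℤ) ^ (f x + Tr n (μ * x)).val

/-- The orbit of a base block `B ⊆ GF(2^n)` under the general affine group `GA₁(2^n)`,
i.e. the set of all blocks `aB + b` with `a ≠ 0`. -/
def affOrbit {n : ℕ} (B : Set (GaloisField 2 n)) : Set (Set (GaloisField 2 n)) :=
  {S | ∃ a b : GaloisField 2 n, a ≠ 0 ∧ S = (fun x => a * x + b) '' B}

/-- `N_E(a,b,c)`: the number of triples `(x,y,z) ∈ E³` with `ax + by + cz = 0`. -/
noncomputable def NE {n : ℕ} (E : Set (GaloisField 2 n)) (a b c : GaloisField 2 n) : ℕ :=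
  Nat.card {t : GaloisField 2 n × GaloisField 2 n × GaloisField 2 n //
    t.1 ∈ E ∧ t.2.1 ∈ E ∧ t.2.2 ∈ E ∧ a * t.1 + b * t.2.1 + c * t.2.2 = 0}

/-- `I_B(u₁,u₂,u₃)`: the number of pairs `(x,y) ∈ GF(2^n)²` with `uᵢ x + y ∈ B` for `i = 1,2,3`. -/
noncomputable def IB {n : ℕ} (B : Set (GaloisField 2 n)) (u₁ u₂ u₃ : GaloisField 2 n) : ℕ :=
  Nat.card {p : GaloisField 2 n × GaloisField 2 n //
    u₁ * p.1 + p.2 ∈ B ∧ u₂ * p.1 + p.2 ∈ B ∧ u₃ * p.1 + p.2 ∈ B}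

/-- The incidence structure `(GF(2^n), affOrbit B)` is a 3-design: there is a `λ` such that
every 3-subset of points lies in exactly `λ` blocks of the orbit. -/
def Is3Design {n : ℕ} (B : Set (GaloisField 2 n)) : Prop :=
  ∃ lam : ℕ, ∀ u v w : GaloisField 2 n, u ≠ v → u ≠ w → v ≠ w →
    Nat.card {S : Set (GaloisField 2 n) // S ∈ affOrbit B ∧ u ∈ S ∧ v ∈ S ∧ w ∈ S} = lam

/-- The canonical additive character of `GF(2^n)`, with values in `{1, -1}`. -/
noncomputable def traceSign (n : ℕ) (x : GaloisField 2 n) : ℤ := (-1) ^ (Tr n x).val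

lemma neg_one_pow_val_add (a b : ZMod 2) :
    (-1 : ℤ) ^ (a + b).val = (-1) ^ a.val * (-1) ^ b.val := by
  revert a b; decide

section TraceSign

variable {n : ℕ}

lemma traceSign_add (x y : GaloisField 2 n) :
    traceSign n (x + y) = traceSign n x * traceSign n y := by
  simp only [traceSign, Tr, map_add, neg_one_pow_val_add]

lemma traceSign_zero : traceSign n 0 = 1 := by
  simp [traceSign, Tr]

lemma exists_traceSign_ne_one : ∃ x : GaloisField 2 n, traceSign n x ≠ 1 := by
  obtain ⟨x, hx⟩ := Algebra.trace_surjective (ZMod 2) (GaloisField 2 n) 1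
  refine ⟨x, ?_⟩
  simp only [traceSign, Tr, hx]
  decide

lemma sum_traceSign : ∑ x : GaloisField 2 n, traceSign n x = 0 := by
  obtain ⟨c, hc⟩ := exists_traceSign_ne_one (n := n)
  have h : ∑ x : GaloisField 2 n, traceSign n x
      = traceSign n c * ∑ x : GaloisField 2 n, traceSign n x := by
    rw [Finset.mul_sum, ← Equiv.sum_comp (Equiv.addLeft c)]
    simp [traceSign_add]
  have h' : (traceSign n c - 1) * ∑ x : GaloisField 2 n, traceSign n x = 0 := by
    linear_combination -h
  exact (mul_eq_zero.1 h').resolve_left (sub_ne_zero.2 hc)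

lemma sum_traceSign_mul [DecidableEq (GaloisField 2 n)] (a : GaloisField 2 n) :
    ∑ x : GaloisField 2 n, traceSign n (x * a)
      = if a = 0 then (Fintype.card (GaloisField 2 n) : ℤ) else 0 := by
  split_ifs with h
  · simp [h, traceSign_zero]
  · exact (Equiv.sum_comp (Equiv.mulRight₀ a h) (traceSign n)).trans sum_traceSign

/-- A triple product of Fourier transforms, summed over all frequencies, is a sum over
the solutions of a linear equation. -/
lemma sum_mul_transforms (G : GaloisField 2 n → ℤ) (v w : GaloisField 2 n) :
    ∑ g : GaloisField 2 n, (∑ x, G x * traceSign n (g * x))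
        * (∑ y, G y * traceSign n (g * (v * y))) * (∑ z, G z * traceSign n (g * (w * z)))
      = Fintype.card (GaloisField 2 n) * ∑ y, ∑ z, G (v * y + w * z) * G y * G z := by
  classical
  have key : ∀ y z : GaloisField 2 n,
      ∑ x, ∑ g : GaloisField 2 n, G x * G y * G z * traceSign n (g * (x + (v * y + w * z)))
        = Fintype.card (GaloisField 2 n) * (G (v * y + w * z) * G y * G z) := by
    intro y z
    simp_rw [← Finset.mul_sum, sum_traceSign_mul, CharTwo.add_eq_zero]
    simp
    ring
  calc _ = ∑ g : GaloisField 2 n, ∑ x, ∑ y, ∑ z,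
        G x * G y * G z * traceSign n (g * (x + (v * y + w * z))) := by
        refine Finset.sum_congr rfl fun g _ => ?_
        rw [Finset.sum_mul_sum, Finset.sum_mul]
        refine Finset.sum_congr rfl fun x _ => ?_
        rw [Finset.sum_mul_sum]
        refine Finset.sum_congr rfl fun y _ => Finset.sum_congr rfl fun z _ => ?_
        rw [mul_add, mul_add, traceSign_add, traceSign_add]
        ring
    _ = ∑ y, ∑ z, ∑ x, ∑ g : GaloisField 2 n,
        G x * G y * G z * traceSign n (g * (x + (v * y + w * z))) := by
        have swap : ∀ g : GaloisField 2 n, ∑ x, ∑ y, ∑ z,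
            G x * G y * G z * traceSign n (g * (x + (v * y + w * z)))
              = ∑ y, ∑ z, ∑ x, G x * G y * G z * traceSign n (g * (x + (v * y + w * z))) :=
          fun g => Finset.sum_comm.trans (Finset.sum_congr rfl fun y _ => Finset.sum_comm)
        simp_rw [swap]
        exact Finset.sum_comm.trans <| Finset.sum_congr rfl fun y _ =>
          Finset.sum_comm.trans <| Finset.sum_congr rfl fun z _ => Finset.sum_comm
    _ = _ := by
        simp_rw [key, ← Finset.mul_sum]

lemma walsh_charFun (B : Set (GaloisField 2 n)) (μ : GaloisField 2 n) :
    walsh (charFun B) μ = ∑ x, (-1 : ℤ) ^ (charFun B x).val * traceSign n (μ * x) := by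
  simp only [walsh, neg_one_pow_val_add, traceSign]

end TraceSign

section Pow

variable {K : Type*} [Field K] [Fintype K]

lemma pow_bijective_of_coprime {m : ℕ} (h0 : 0 < m)
    (hm : Nat.Coprime m (Fintype.card K - 1)) : Function.Bijective fun x : K => x ^ m := by
  classical
  refine Finite.injective_iff_bijective.1 fun x y (hxy : x ^ m = y ^ m) => ?_
  by_cases hx : x = 0
  · subst hx
    rw [zero_pow h0.ne'] at hxy
    exact (pow_eq_zero_iff h0.ne').1 hxy.symm |>.symm
  by_cases hy : y = 0
  · subst hy
    rw [zero_pow h0.ne'] at hxy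
    exact (pow_eq_zero_iff h0.ne').1 hxy
  have hc : (Nat.card Kˣ).Coprime m := by
    rw [Nat.card_eq_fintype_card, Fintype.card_units]; exact hm.symm
  have := (powCoprime hc).injective (a₁ := Units.mk0 x hx) (a₂ := Units.mk0 y hy)
    (by ext; simpa using hxy)
  simpa using congrArg Units.val this

end Pow

/-- The number of `(y, z) ∈ B²` with `u y + (1 + u) z ∈ B`. -/
noncomputable def pairCount {n : ℕ} (B : Set (GaloisField 2 n)) (u : GaloisField 2 n) : ℕ :=
  Nat.card {p : GaloisField 2 n × GaloisField 2 n //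
    p.1 ∈ B ∧ p.2 ∈ B ∧ u * p.1 + (1 + u) * p.2 ∈ B}

/-- The number of affine permutations that fix `B` setwise. -/
noncomputable def affStabCard {n : ℕ} (B : Set (GaloisField 2 n)) : ℕ :=
  Nat.card {p : GaloisField 2 n × GaloisField 2 n //
    p.1 ≠ 0 ∧ (fun x => p.1 * x + p.2) '' B = B}

section Counting

variable {n : ℕ}

lemma affStabCard_pos (B : Set (GaloisField 2 n)) : 0 < affStabCard B := by
  have : Nonempty {p : GaloisField 2 n × GaloisField 2 n //
      p.1 ≠ 0 ∧ (fun x => p.1 * x + p.2) '' B = B} := ⟨⟨(1, 0), by simp⟩⟩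
  exact Nat.card_pos

/-- Every block of the orbit is the image of `B` under exactly `affStabCard B` affine
permutations. -/
lemma card_affine_image_eq (B S : Set (GaloisField 2 n)) (hS : S ∈ affOrbit B) :
    Nat.card {p : GaloisField 2 n × GaloisField 2 n //
      p.1 ≠ 0 ∧ (fun x => p.1 * x + p.2) '' B = S} = affStabCard B := by
  obtain ⟨a, b, ha, rfl⟩ := hS
  have hinj : Function.Injective fun x : GaloisField 2 n => a * x + b := fun x y h => by
    simpa [ha] using h
  symm
  refine Nat.card_congr (Equiv.subtypeEquiv
    ((Equiv.mulLeft₀ a ha).prodCongr ((Equiv.mulLeft₀ a ha).trans (Equiv.addRight b))) ?_)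
  rintro ⟨c, e⟩
  have : (fun x => a * c * x + (a * e + b)) '' B
      = (fun x => a * x + b) '' ((fun x => c * x + e) '' B) := by
    rw [Set.image_image]
    congr 1
    ext x
    ring
  change _ ↔ a * c ≠ 0 ∧ (fun x => a * c * x + (a * e + b)) '' B = _
  rw [this, hinj.image_injective.eq_iff]
  simp [ha]

lemma card_blocks_mul_affStabCard (B : Set (GaloisField 2 n)) (P : Set (GaloisField 2 n) → Prop) :
    Nat.card {S // S ∈ affOrbit B ∧ P S} * affStabCard B
      = Nat.card {p : GaloisField 2 n × GaloisField 2 n //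
        p.1 ≠ 0 ∧ P ((fun x => p.1 * x + p.2) '' B)} := by
  classical
  let g : {p : GaloisField 2 n × GaloisField 2 n //
        p.1 ≠ 0 ∧ P ((fun x => p.1 * x + p.2) '' B)} → {S // S ∈ affOrbit B ∧ P S} :=
    fun p => ⟨(fun x => p.1.1 * x + p.1.2) '' B, ⟨p.1.1, p.1.2, p.2.1, rfl⟩, p.2.2⟩
  have hfib : ∀ S, Nat.card {p // g p = S} = affStabCard B := by
    rintro ⟨S, hS, hP⟩
    rw [← card_affine_image_eq B S hS]
    refine Nat.card_congr ⟨fun p => ⟨p.1.1, p.1.2.1, congrArg Subtype.val p.2⟩,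
      fun p => ⟨⟨p.1, p.2.1, by rw [p.2.2]; exact hP⟩, Subtype.ext p.2.2⟩,
      fun _ => rfl, fun _ => rfl⟩
  have : Fintype {S // S ∈ affOrbit B ∧ P S} := Fintype.ofFinite _
  rw [← Nat.card_congr (Equiv.sigmaFiberEquiv g), Nat.card_sigma]
  simp only [hfib, Finset.sum_const, smul_eq_mul, Finset.card_univ, Nat.card_eq_fintype_card]

lemma card_affine_through_points (B : Set (GaloisField 2 n)) {p q : GaloisField 2 n}
    (hpq : p ≠ q) (u : GaloisField 2 n) :
    Nat.card {c : GaloisField 2 n × GaloisField 2 n // c.1 ≠ 0 ∧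
        (p ∈ (fun x => c.1 * x + c.2) '' B ∧ q ∈ (fun x => c.1 * x + c.2) '' B ∧
          u * q + (1 + u) * p ∈ (fun x => c.1 * x + c.2) '' B)}
      = Nat.card {c : GaloisField 2 n × GaloisField 2 n // c.1 ≠ c.2 ∧
          (c.1 ∈ B ∧ c.2 ∈ B ∧ u * c.1 + (1 + u) * c.2 ∈ B)} := by
  have hmem : ∀ a b z : GaloisField 2 n, a ≠ 0 →
      (z ∈ (fun x => a * x + b) '' B ↔ (z - b) / a ∈ B) := by
    intro a b z ha
    constructor
    · rintro ⟨x, hx, rfl⟩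
      simpa [ha] using hx
    · intro h
      exact ⟨_, h, by field_simp; ring⟩
  have htwo : (2 : GaloisField 2 n) = 0 := CharTwo.two_eq_zero
  refine Nat.card_congr ⟨fun c => ⟨((q - c.1.2) / c.1.1, (p - c.1.2) / c.1.1), ?_⟩,
    fun c => ⟨((q - p) / (c.1.1 - c.1.2), p - (q - p) / (c.1.1 - c.1.2) * c.1.2), ?_⟩, ?_, ?_⟩
  · obtain ⟨⟨a, b⟩, ha, h1, h2, h3⟩ := c
    simp only at ha h1 h2 h3 ⊢
    rw [hmem _ _ _ ha] at h1 h2 h3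
    refine ⟨?_, h2, h1, ?_⟩
    · intro h
      field_simp at h
      exact hpq (by linear_combination -h)
    · convert h3 using 1
      field_simp
      linear_combination (-u * b) * htwo
  · obtain ⟨⟨y, z⟩, hyz, h1, h2, h3⟩ := c
    simp only at hyz h1 h2 h3 ⊢
    have h := sub_ne_zero.2 hyz
    refine ⟨div_ne_zero (sub_ne_zero.2 hpq.symm) h, ⟨z, h2, by ring⟩, ⟨y, h1, ?_⟩, ⟨_, h3, ?_⟩⟩
    · simp only
      field_simp
      ring
    · simp only
      field_simp
      linear_combination (u * (z * q - p * y)) * htwo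
  · rintro ⟨⟨a, b⟩, ha, -⟩
    have h := sub_ne_zero.2 hpq.symm
    simp only at ha
    have e : (q - b) / a - (p - b) / a = (q - p) / a := by ring
    refine Subtype.ext (Prod.ext ?_ ?_)
    · simp only [e]; field_simp
    · simp only [e]; field_simp; ring
  · rintro ⟨⟨y, z⟩, hyz, -⟩
    simp only at hyz
    have h := sub_ne_zero.2 hyz
    have h' := sub_ne_zero.2 hpq.symm
    refine Subtype.ext (Prod.ext ?_ ?_)
    · simp only; field_simp; ring
    · simp only; field_simp; ring

lemma card_offDiag_add_ncard (B : Set (GaloisField 2 n)) (u : GaloisField 2 n) :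
    Nat.card {c : GaloisField 2 n × GaloisField 2 n // c.1 ≠ c.2 ∧
        (c.1 ∈ B ∧ c.2 ∈ B ∧ u * c.1 + (1 + u) * c.2 ∈ B)} + B.ncard = pairCount B u := by
  classical
  have htwo : (2 : GaloisField 2 n) = 0 := CharTwo.two_eq_zero
  have hd : B.ncard = Nat.card {c : GaloisField 2 n × GaloisField 2 n // c.1 = c.2 ∧
        (c.1 ∈ B ∧ c.2 ∈ B ∧ u * c.1 + (1 + u) * c.2 ∈ B)} := by
    refine Nat.card_congr ⟨fun x => ⟨(x.1, x.1), rfl, x.2, x.2, ?_⟩,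
      fun c => ⟨c.1.1, c.2.2.1⟩, fun _ => rfl, fun c => Subtype.ext (Prod.ext rfl c.2.1)⟩
    convert x.2 using 1
    linear_combination (u * x.1) * htwo
  rw [hd, pairCount]
  simp only [Nat.card_eq_fintype_card, Fintype.card_subtype]
  rw [← Finset.card_filter_add_card_filter_not (s := univ.filter
    fun c : GaloisField 2 n × GaloisField 2 n =>
      c.1 ∈ B ∧ c.2 ∈ B ∧ u * c.1 + (1 + u) * c.2 ∈ B) (fun c => c.1 ≠ c.2)]
  simp only [Finset.filter_filter, not_not]
  simp only [and_comm]

lemma card_blocks_through (B : Set (GaloisField 2 n)) {p q : GaloisField 2 n}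
    (hpq : p ≠ q) (u : GaloisField 2 n) :
    Nat.card {S : Set (GaloisField 2 n) //
        S ∈ affOrbit B ∧ p ∈ S ∧ q ∈ S ∧ u * q + (1 + u) * p ∈ S} * affStabCard B + B.ncard
      = pairCount B u := by
  rw [card_blocks_mul_affStabCard B fun S => p ∈ S ∧ q ∈ S ∧ u * q + (1 + u) * p ∈ S,
    card_affine_through_points B hpq, card_offDiag_add_ncard]

lemma is3Design_iff_pairCount (B : Set (GaloisField 2 n)) :
    Is3Design B ↔ ∃ c : ℕ, ∀ u : GaloisField 2 n, u ≠ 0 → u ≠ 1 → pairCount B u = c := by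
  have htwo : (2 : GaloisField 2 n) = 0 := CharTwo.two_eq_zero
  constructor
  · rintro ⟨lam, h⟩
    refine ⟨lam * affStabCard B + B.ncard, fun u h0 h1 => ?_⟩
    rw [← card_blocks_through B zero_ne_one u, h 0 1 _ zero_ne_one]
    · simpa using h0.symm
    · simpa using h1.symm
  · rintro ⟨c, h⟩
    refine ⟨(c - B.ncard) / affStabCard B, fun p q r hpq hpr hqr => ?_⟩
    have hqp := sub_ne_zero.2 hpq.symm
    have hr : (r - p) / (q - p) * q + (1 + (r - p) / (q - p)) * p = r := by
      field_simp
      linear_combination (p * (r - p)) * htwo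
    have key := card_blocks_through B hpq ((r - p) / (q - p))
    rw [hr, h _ (div_ne_zero (sub_ne_zero.2 hpr.symm) hqp)
      (fun e => hqr (by rw [div_eq_one_iff_eq hqp] at e; exact (sub_left_injective e).symm))] at key
    rw [← key, Nat.add_sub_cancel, Nat.mul_div_cancel _ (affStabCard_pos B)]

lemma eight_mul_pairCount (B : Set (GaloisField 2 n)) {u : GaloisField 2 n} (h0 : u ≠ 0)
    (h1 : u ≠ 1) :
    (8 : ℤ) * pairCount B u
      = (Fintype.card (GaloisField 2 n) : ℤ) ^ 2
        - 3 * Fintype.card (GaloisField 2 n) * ∑ x, (-1 : ℤ) ^ (charFun B x).val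
        + 3 * (∑ x, (-1 : ℤ) ^ (charFun B x).val) ^ 2
        - ∑ y, ∑ z, (-1 : ℤ) ^ (charFun B (u * y + (1 + u) * z)).val
          * (-1 : ℤ) ^ (charFun B y).val * (-1 : ℤ) ^ (charFun B z).val := by
  classical
  set F : GaloisField 2 n → ℤ := fun x => (-1 : ℤ) ^ (charFun B x).val with hF
  have hFB : ∀ x, 1 - F x = if x ∈ B then 2 else 0 := by
    intro x
    by_cases hx : x ∈ B
    · simp [hF, charFun, hx, ZMod.val_one]
    · simp [hF, charFun, hx]
  have hu1 : 1 + u ≠ 0 := fun h => h1 (CharTwo.add_eq_zero.1 h).symm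
  have hsumz : ∀ y, ∑ z, F (u * y + (1 + u) * z) = ∑ z, F z := fun y =>
    Equiv.sum_comp ((Equiv.mulLeft₀ (1 + u) hu1).trans (Equiv.addLeft (u * y))) F
  have hsumy : ∀ z, ∑ y, F (u * y + (1 + u) * z) = ∑ y, F y := fun z =>
    Equiv.sum_comp ((Equiv.mulLeft₀ u h0).trans (Equiv.addRight ((1 + u) * z))) F
  have hJ : (8 : ℤ) * pairCount B u
      = ∑ y, ∑ z, (1 - F y) * (1 - F z) * (1 - F (u * y + (1 + u) * z)) := by
    rw [pairCount, Nat.card_eq_fintype_card, Fintype.card_subtype, Finset.card_filter,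
      ← Finset.sum_product', Finset.univ_product_univ, Nat.cast_sum, Finset.mul_sum]
    refine Finset.sum_congr rfl fun p _ => ?_
    simp only [hFB]
    by_cases a : p.1 ∈ B <;> by_cases b : p.2 ∈ B <;>
      by_cases c : u * p.1 + (1 + u) * p.2 ∈ B <;> simp [a, b, c]
  have e1 : ∑ y, ∑ z, F y * F (u * y + (1 + u) * z) = (∑ x, F x) ^ 2 := by
    simp_rw [← Finset.mul_sum, hsumz, ← Finset.sum_mul, sq]
  have e2 : ∑ y, ∑ z, F z * F (u * y + (1 + u) * z) = (∑ x, F x) ^ 2 := by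
    rw [Finset.sum_comm]
    simp_rw [← Finset.mul_sum, hsumy, ← Finset.sum_mul, sq]
  have e3 : ∑ y, ∑ z, F y * F z = (∑ x, F x) ^ 2 := by
    rw [sq, Finset.sum_mul_sum]
  have e4 : ∑ y : GaloisField 2 n, ∑ z, F (u * y + (1 + u) * z)
      = Fintype.card (GaloisField 2 n) * ∑ x, F x := by
    simp [hsumz]
  have e5 : ∑ y : GaloisField 2 n, ∑ z, F z = Fintype.card (GaloisField 2 n) * ∑ x, F x := by
    simp
  have e6 : ∑ y, ∑ _z : GaloisField 2 n, F y = Fintype.card (GaloisField 2 n) * ∑ x, F x := by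
    simp [Finset.mul_sum]
  have e7 : ∑ _y : GaloisField 2 n, ∑ _z : GaloisField 2 n, (1 : ℤ)
      = (Fintype.card (GaloisField 2 n) : ℤ) ^ 2 := by
    simp [sq]
  have expand : ∀ y z, (1 - F y) * (1 - F z) * (1 - F (u * y + (1 + u) * z))
      = 1 - F y - F z - F (u * y + (1 + u) * z) + F y * F z + F y * F (u * y + (1 + u) * z)
        + F z * F (u * y + (1 + u) * z) - F (u * y + (1 + u) * z) * F y * F z := by
    intro y z; ring
  rw [hJ]
  simp_rw [expand, Finset.sum_sub_distrib, Finset.sum_add_distrib, Finset.sum_sub_distrib]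
  rw [e1, e2, e3, e4, e5, e6, e7]
  ring

lemma sum_traceSign_power {t : ℕ} (ht : Function.Bijective fun x : GaloisField 2 n => x ^ t)
    (v w : GaloisField 2 n) (hv : v ^ t ≠ 1) :
    ∑ y, ∑ z, traceSign n ((v * y + w * z) ^ t) * traceSign n (y ^ t) * traceSign n (z ^ t)
      = Fintype.card (GaloisField 2 n)
        * ((Nat.card {x : GaloisField 2 n // (v * x + w) ^ t + x ^ t + 1 = 0} : ℤ) - 1) := by
  classical
  have ht0 : t ≠ 0 := by
    rintro rfl
    exact zero_ne_one (ht.1 (a₁ := (0 : GaloisField 2 n)) (a₂ := 1) (by simp))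
  have hpow : ∀ a : GaloisField 2 n, ∑ z : GaloisField 2 n, traceSign n (z ^ t * a)
      = if a = 0 then (Fintype.card (GaloisField 2 n) : ℤ) else 0 := fun a => by
    rw [← sum_traceSign_mul]
    exact (Equiv.ofBijective _ ht).sum_comp fun x => traceSign n (x * a)
  simp_rw [← traceSign_add]
  rw [Finset.sum_comm, ← Finset.add_sum_erase _ _ (Finset.mem_univ 0)]
  have hzero : ∑ y, traceSign n ((v * y + w * 0) ^ t + y ^ t + 0 ^ t) = 0 := by
    have : ∀ y, (v * y + w * 0) ^ t + y ^ t + 0 ^ t = y ^ t * (v ^ t + 1) := fun y => by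
      rw [zero_pow ht0, mul_zero, add_zero, add_zero, mul_pow]; ring
    simp_rw [this]
    rw [hpow, if_neg fun h => hv (CharTwo.add_eq_zero.1 h)]
  have hne : ∀ z ∈ univ.erase (0 : GaloisField 2 n),
      ∑ y, traceSign n ((v * y + w * z) ^ t + y ^ t + z ^ t)
        = ∑ s, traceSign n (z ^ t * ((v * s + w) ^ t + s ^ t + 1)) := fun z hz => by
    rw [← Equiv.sum_comp (Equiv.mulLeft₀ z (Finset.ne_of_mem_erase hz))]
    refine Finset.sum_congr rfl fun s _ => congrArg _ ?_
    change (v * (z * s) + w * z) ^ t + (z * s) ^ t + z ^ t = _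
    rw [show v * (z * s) + w * z = z * (v * s + w) by ring, mul_pow, mul_pow]
    ring
  rw [hzero, Finset.sum_congr rfl hne, Finset.sum_comm]
  have hin : ∀ s : GaloisField 2 n,
      ∑ z ∈ univ.erase (0 : GaloisField 2 n), traceSign n (z ^ t * ((v * s + w) ^ t + s ^ t + 1))
        = (if (v * s + w) ^ t + s ^ t + 1 = 0 then (Fintype.card (GaloisField 2 n) : ℤ) else 0)
          - 1 := fun s => by
    rw [← hpow, ← Finset.add_sum_erase _ _ (Finset.mem_univ 0), zero_pow ht0, zero_mul,
      traceSign_zero]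
    ring
  simp_rw [hin, Finset.sum_sub_distrib]
  rw [← Finset.sum_filter, Nat.card_eq_fintype_card, Fintype.card_subtype]
  simp
  ring

end Counting

/-- Theorem 2.9: when `f̂_B(μ) = Σ_x (-1)^{Tr(x^t + μ^d x)}` with `gcd(td, q-1) = 1`, the orbit
of `B` is a 3-design iff the number of solutions of `(u^d x + (1+u)^d)^t + x^t + 1 = 0`
is independent of `u ∈ GF(q) ∖ GF(2)`. -/
theorem stmt_9 (n k t d : ℕ) (hn : 0 < n) (hk : 3 ≤ k) (ht : 0 < t) (hd : 0 < d)
    (hgcd : Nat.gcd (t * d) (2 ^ n - 1) = 1)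
    (B : Set (GaloisField 2 n)) (hB : B.ncard = k)
    (hW : ∀ μ : GaloisField 2 n, walsh (charFun B) μ
      = ∑ x : GaloisField 2 n, (-1 : ℤ) ^ (Tr n (x ^ t + μ ^ d * x)).val) :
    Is3Design B ↔ ∃ c : ℕ, ∀ u : GaloisField 2 n, u ≠ 0 → u ≠ 1 →
      Nat.card {x : GaloisField 2 n //
        (u ^ d * x + (1 + u) ^ d) ^ t + x ^ t + 1 = 0} = c := by
  have hcard : Fintype.card (GaloisField 2 n) = 2 ^ n := by
    rw [← Nat.card_eq_fintype_card, GaloisField.card 2 n hn.ne']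
  have hq : (Fintype.card (GaloisField 2 n) : ℤ) ≠ 0 := by exact_mod_cast Fintype.card_ne_zero
  rw [← hcard] at hgcd
  have hbt : Function.Bijective fun x : GaloisField 2 n => x ^ t :=
    pow_bijective_of_coprime ht (Nat.Coprime.coprime_mul_right hgcd)
  have hbd : Function.Bijective fun x : GaloisField 2 n => x ^ d :=
    pow_bijective_of_coprime hd (Nat.Coprime.coprime_mul_left hgcd)
  have hwalsh : ∀ μ : GaloisField 2 n,
      ∑ x, (-1 : ℤ) ^ (charFun B x).val * traceSign n (μ * x)
        = ∑ x, traceSign n (x ^ t) * traceSign n (μ ^ d * x) := fun μ => by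
    rw [← walsh_charFun, hW]
    exact Finset.sum_congr rfl fun x _ => traceSign_add _ _
  have hT : ∀ u : GaloisField 2 n, u ≠ 1 →
      ∑ y, ∑ z, (-1 : ℤ) ^ (charFun B (u * y + (1 + u) * z)).val
          * (-1 : ℤ) ^ (charFun B y).val * (-1 : ℤ) ^ (charFun B z).val
        = Fintype.card (GaloisField 2 n) * ((Nat.card {x : GaloisField 2 n //
          (u ^ d * x + (1 + u) ^ d) ^ t + x ^ t + 1 = 0} : ℤ) - 1) := fun u hu => by
    have hv : (u ^ d) ^ t ≠ 1 := fun h => hu <| hbd.1 <| hbt.1 <| by simpa using h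
    rw [← sum_traceSign_power hbt _ _ hv]
    refine mul_left_cancel₀ hq ?_
    rw [← sum_mul_transforms (fun x => (-1 : ℤ) ^ (charFun B x).val),
      ← sum_mul_transforms fun x => traceSign n (x ^ t)]
    refine Fintype.sum_equiv (Equiv.ofBijective _ hbd) _ _ fun g => ?_
    simp only [Equiv.ofBijective_apply, ← mul_assoc, hwalsh, mul_pow]
  rw [is3Design_iff_pairCount]
  have key : ∀ u : GaloisField 2 n, u ≠ 0 → u ≠ 1 → ∀ u' : GaloisField 2 n, u' ≠ 0 → u' ≠ 1 →
      (pairCount B u = pairCount B u' ↔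
        Nat.card {x : GaloisField 2 n // (u ^ d * x + (1 + u) ^ d) ^ t + x ^ t + 1 = 0}
          = Nat.card {x : GaloisField 2 n //
            (u' ^ d * x + (1 + u') ^ d) ^ t + x ^ t + 1 = 0}) := by
    intro u h0 h1 u' h0' h1'
    have e := eight_mul_pairCount B h0 h1
    have e' := eight_mul_pairCount B h0' h1'
    rw [hT u h1] at e
    rw [hT u' h1'] at e'
    constructor
    · intro h
      rw [h] at e
      have := mul_left_cancel₀ hq (sub_right_injective (e.symm.trans e'))
      exact_mod_cast sub_left_injective this
    · intro h
      rw [h] at e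
      have : (pairCount B u : ℤ) = pairCount B u' := by linarith
      exact_mod_cast this
  by_cases hex : ∃ w : GaloisField 2 n, w ≠ 0 ∧ w ≠ 1
  · obtain ⟨w, h0, h1⟩ := hex
    constructor
    · rintro ⟨c, hc⟩
      exact ⟨_, fun u hu0 hu1 => (key u hu0 hu1 w h0 h1).1 ((hc u hu0 hu1).trans (hc w h0 h1).symm)⟩
    · rintro ⟨c, hc⟩
      exact ⟨_, fun u hu0 hu1 => (key u hu0 hu1 w h0 h1).2 ((hc u hu0 hu1).trans (hc w h0 h1).symm)⟩
  · push Not at hex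
    exact ⟨fun _ => ⟨0, fun u hu0 hu1 => absurd (hex u hu0) hu1⟩,
      fun _ => ⟨0, fun u hu0 hu1 => absurd (hex u hu0) hu1⟩⟩
end

section
/- Let n be an odd integer, q = 2^n, and let i be a positive integer with gcd(i, n) = 1. Let s = 2^{2i} − 2^i + 1, let e be the multiplicative inverse of 2^i + 1 modulo q − 1, and let B = GF(q) ∖ { ((x+1)^s + x^s + 1)^e : x ∈ GF(q) }. Then the incidence structure (GF(q), GA₁(q)(B)) is a 3-(q, q/2, q(q−4)/8) design; that is, |B| = q/2, every block of the orbit GA₁(q)(B) has size q/2, and every 3-subset of GF(q) is contained in exactly q(q−4)/8 blocks of the orbit GA₁(q)(B). -/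
open Finset

/-- A nontrivial additive character with values in `ℤ` that is invariant under squaring and
takes the value `-1` at `1`, as the character `(-1) ^ Tr x` does in odd degree. -/
structure IsTraceChar {F : Type*} [Field F] (χ : AddChar F ℤ) : Prop where
  map_sq : ∀ x, χ (x ^ 2) = χ x
  map_one : χ 1 = -1

/-- The field automorphism `σ` generates the Galois group over the prime field: it preserves `χ`,
fixes only `0` and `1`, and has injective norm form `x * σ x`. -/
structure IsTraceGen {F : Type*} [Field F] (χ : AddChar F ℤ) (σ : F ≃+* F) : Prop where
  map_char : ∀ x, χ (σ x) = χ x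
  fixed : ∀ x, σ x = x → x = 0 ∨ x = 1
  norm_injective : Function.Injective fun x => x * σ x

/-- The cubic exponential sum `∑ χ(u + u³ / c)`. -/
def cubicSum {F : Type*} [Field F] [Fintype F] (χ : AddChar F ℤ) (c : F) : ℤ :=
  ∑ u : F, χ (u + u ^ 3 / c)

section TraceChar

variable {F : Type*} [Field F] [Fintype F] [DecidableEq F] [CharP F 2] {χ : AddChar F ℤ}

omit [Fintype F] [DecidableEq F] in
theorem char_mul_self (χ : AddChar F ℤ) (x : F) : χ x * χ x = 1 := by
  rw [← AddChar.map_add_eq_mul, CharTwo.add_self_eq_zero, AddChar.map_zero_eq_one]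

omit [Fintype F] [DecidableEq F] in
theorem char_eq_one_or (χ : AddChar F ℤ) (x : F) : χ x = 1 ∨ χ x = -1 :=
  mul_self_eq_one_iff.mp (char_mul_self χ x)

omit [DecidableEq F] [CharP F 2] in
theorem cubicSum_eq {c : F} (hc : c ≠ 0) :
    cubicSum χ c = ∑ u, χ (c * u + c ^ 2 * u ^ 3) := by
  symm
  refine Fintype.sum_bijective (fun x => c * x) (mulLeft_bijective₀ c hc) _ _ fun u => ?_
  congr 1
  field_simp

omit [DecidableEq F] [CharP F 2] in
theorem cubicSum_map {σ : F ≃+* F} (hσ : ∀ x, χ (σ x) = χ x) (c : F) :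
    cubicSum χ (σ c) = cubicSum χ c := by
  symm
  refine Fintype.sum_equiv σ.toEquiv _ _ fun u => ?_
  rw [← hσ]
  simp

namespace IsTraceChar

omit [Fintype F] [DecidableEq F] in
theorem map_sq_add (h : IsTraceChar χ) (z : F) : χ (z ^ 2 + z) = 1 := by
  rw [AddChar.map_add_eq_mul, h.map_sq, char_mul_self]

omit [Fintype F] [DecidableEq F] [CharP F 2] in
theorem isPrimitive (h : IsTraceChar χ) : χ.IsPrimitive := by
  refine AddChar.IsPrimitive.of_ne_one fun h1 => ?_
  have := h.map_one
  rw [h1] at this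
  simp at this

omit [CharP F 2] in
theorem sum_mul (h : IsTraceChar χ) (b : F) :
    ∑ x, χ (x * b) = if b = 0 then (Fintype.card F : ℤ) else 0 := by
  have := AddChar.sum_mulShift b h.isPrimitive
  split_ifs at this ⊢ <;> simpa using this

omit [DecidableEq F] [CharP F 2] in
theorem sum_eq_zero (h : IsTraceChar χ) : ∑ x, χ x = 0 := by
  classical simpa using h.sum_mul 1

theorem sum_mul_sq (h : IsTraceChar χ) (b : F) :
    ∑ x, χ (b * x ^ 2) = if b = 0 then (Fintype.card F : ℤ) else 0 := by
  rw [← h.sum_mul b]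
  exact Fintype.sum_equiv (frobeniusEquiv F 2).toEquiv _ _ fun x => by
    simp [frobeniusEquiv_apply, frobenius_def, mul_comm]

omit [Fintype F] [DecidableEq F] in
theorem cube_injective (h : IsTraceChar χ) : Function.Injective fun x : F => x ^ 3 := by
  intro x y hxy
  by_contra hne
  have hxy : x ^ 3 = y ^ 3 := hxy
  have hy : y ≠ 0 := by
    rintro rfl
    exact hne (by simpa using hxy)
  have h1 : (x / y) ^ 2 + x / y = 1 := by
    have : x + y ≠ 0 := fun h0 => hne (CharTwo.add_eq_zero.mp h0)
    field_simp
    apply mul_left_cancel₀ this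
    grind
  have := h.map_sq_add (x / y)
  rw [h1, h.map_one] at this
  norm_num at this

omit [DecidableEq F] in
theorem cube_bijective (h : IsTraceChar χ) : Function.Bijective fun x : F => x ^ 3 :=
  Finite.injective_iff_bijective.mp h.cube_injective

omit [DecidableEq F] in
theorem exists_cube_eq (h : IsTraceChar χ) (c : F) : ∃ a : F, a ^ 3 = c :=
  h.cube_bijective.2 c

omit [DecidableEq F] in
theorem sum_mul_cube (h : IsTraceChar χ) {b : F} (hb : b ≠ 0) : ∑ x, χ (b * x ^ 3) = 0 := by
  rw [← h.sum_eq_zero]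
  refine Fintype.sum_bijective (fun x => b * x ^ 3) ?_ _ _ fun x => rfl
  exact (mulLeft_bijective₀ b hb).comp h.cube_bijective

theorem sum_quadratic (h : IsTraceChar χ) {t : F} (ht : t ≠ 0) (c e : F) :
    ∑ X : F, (if c * X ^ 2 + t ^ 2 * X + e = 0 then (1 : ℤ) else 0) =
      1 + χ (c * e / t ^ 4) - if c = 0 then 1 else 0 := by
  have hq : (Fintype.card F : ℤ) ≠ 0 := by exact_mod_cast Fintype.card_ne_zero
  apply mul_left_cancel₀ hq
  have key : ∀ z : F, (Fintype.card F : ℤ) * (if z = 0 then (1 : ℤ) else 0) = ∑ l, χ (l * z) := by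
    intro z
    rw [h.sum_mul]
    split_ifs <;> simp
  rw [Finset.mul_sum]
  simp_rw [key]
  rw [Finset.sum_comm]
  have inner : ∀ l : F, ∑ X, χ (l * (c * X ^ 2 + t ^ 2 * X + e)) =
      if l = 0 ∨ l = c / t ^ 4 then (Fintype.card F : ℤ) * χ (l * e) else 0 := by
    intro l
    have h1 : ∀ X, χ (l * (c * X ^ 2 + t ^ 2 * X + e)) =
        χ (l * e) * χ ((l * c + (l * t ^ 2) ^ 2) * X ^ 2) := by
      intro X
      rw [← AddChar.map_add_eq_mul, ← mul_one (χ (l * (c * X ^ 2 + t ^ 2 * X + e))),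
        ← h.map_sq_add (l * t ^ 2 * X), ← AddChar.map_add_eq_mul]
      congr 1
      grind
    simp_rw [h1]
    rw [← Finset.mul_sum, h.sum_mul_sq]
    have h2 : l * c + (l * t ^ 2) ^ 2 = 0 ↔ l = 0 ∨ l = c / t ^ 4 := by
      have : l * c + (l * t ^ 2) ^ 2 = l * t ^ 4 * (l + c / t ^ 4) := by
        field_simp
        ring
      rw [this]
      simp [ht, CharTwo.add_eq_zero]
    simp only [h2]
    split_ifs <;> ring
  simp_rw [inner]
  by_cases hc : c = 0
  · subst hc
    simp [Finset.sum_ite_eq']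
  · have h0 : c / t ^ 4 ≠ 0 := div_ne_zero hc (pow_ne_zero _ ht)
    rw [Finset.sum_ite, Finset.sum_const_zero, add_zero,
      show (Finset.univ.filter fun l : F => l = 0 ∨ l = c / t ^ 4) = {0, c / t ^ 4} by ext; simp,
      Finset.sum_pair (Ne.symm h0)]
    simp only [zero_mul, AddChar.map_zero_eq_one, hc, if_false]
    rw [div_mul_eq_mul_div]
    ring

omit [DecidableEq F] [CharP F 2] in
theorem cubicSum_zero (h : IsTraceChar χ) : cubicSum χ 0 = 0 := by
  simpa [cubicSum] using h.sum_eq_zero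

omit [DecidableEq F] in
theorem cubicSum_cube (h : IsTraceChar χ) (r : F) :
    cubicSum χ (r ^ 3) = ∑ u, χ (u ^ 3 + r * u) := by
  rcases eq_or_ne r 0 with rfl | hr
  · have := h.sum_mul_cube one_ne_zero
    simp only [one_mul] at this
    simpa [cubicSum, this] using h.sum_eq_zero
  · symm
    refine Fintype.sum_bijective (fun x => r * x) (mulLeft_bijective₀ r hr) _ _ fun u => ?_
    congr 1
    field_simp
    ring

omit [CharP F 2] in
theorem mul_indicator (h : IsTraceChar χ) (z : F) :
    (Fintype.card F : ℤ) * (if z = 0 then 1 else 0) = ∑ l, χ (l * z) := by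
  rw [h.sum_mul]
  split_ifs <;> simp

omit [DecidableEq F] in
theorem sum_comp_cube (h : IsTraceChar χ) (f : F → ℤ) : ∑ x, f (x ^ 3) = ∑ x, f x :=
  Fintype.sum_bijective _ h.cube_bijective _ _ fun _ => rfl

theorem sum_cubicSum_mul (h : IsTraceChar χ) {m l : F} (hm : m ≠ 0) (hl : l ≠ 0) :
    ∑ ν, cubicSum χ (m * ν) * cubicSum χ (l * ν) =
      if m = l then (Fintype.card F : ℤ) ^ 2 else 0 := by
  obtain ⟨a, rfl⟩ := h.exists_cube_eq m
  obtain ⟨b, rfl⟩ := h.exists_cube_eq l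
  have hb : b ≠ 0 := by rintro rfl; simp at hl
  rw [← h.sum_comp_cube]
  simp_rw [← mul_pow, h.cubicSum_cube, Finset.sum_mul_sum]
  rw [Finset.sum_comm]
  simp_rw [Finset.sum_comm (s := (Finset.univ : Finset F)) (t := Finset.univ)
    (f := fun ρ v => χ _ * χ (v ^ 3 + b * ρ * v))]
  have inner : ∀ u v, ∑ ρ, χ (u ^ 3 + a * ρ * u) * χ (v ^ 3 + b * ρ * v) =
      if v = a * u / b then χ (u ^ 3 + v ^ 3) * Fintype.card F else 0 := by
    intro u v
    have h1 : ∀ ρ, χ (u ^ 3 + a * ρ * u) * χ (v ^ 3 + b * ρ * v) =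
        χ (u ^ 3 + v ^ 3) * χ (ρ * (a * u + b * v)) := by
      intro ρ
      rw [← AddChar.map_add_eq_mul, ← AddChar.map_add_eq_mul]
      congr 1
      ring
    simp_rw [h1]
    rw [← Finset.mul_sum, h.sum_mul]
    have h2 : a * u + b * v = 0 ↔ v = a * u / b := by
      rw [CharTwo.add_eq_zero, eq_div_iff hb, eq_comm, mul_comm b]
    simp only [h2]
    split_ifs <;> simp
  simp_rw [inner, Finset.sum_ite_eq', Finset.mem_univ, if_true]
  have h3 : ∀ u, χ (u ^ 3 + (a * u / b) ^ 3) = χ ((1 + (a / b) ^ 3) * u ^ 3) := by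
    intro u
    congr 1
    field_simp
  simp_rw [h3]
  rw [← Finset.sum_mul]
  have h4 : 1 + (a / b) ^ 3 = 0 ↔ a ^ 3 = b ^ 3 := by
    rw [CharTwo.add_eq_zero, eq_comm, div_pow, div_eq_one_iff_eq hl]
  split_ifs with hab
  · rw [h4.mpr hab]
    simp [sq]
  · rw [h.sum_mul_cube (fun h0 => hab (h4.mp h0)), zero_mul]

/-- The number of affine points on the plane cubic `(X³ + a²X²) + (Y³ + b²Y²) = 1`. -/
theorem sum_plane_cubic (h : IsTraceChar χ) (a b : F) :
    ∑ X : F, ∑ Y : F, (if X ^ 3 + a ^ 2 * X ^ 2 + (Y ^ 3 + b ^ 2 * Y ^ 2) = 1 then (1 : ℤ) else 0) =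
      Fintype.card F - χ (a ^ 3 + b ^ 3) * cubicSum χ ((a * b) ^ 3) := by
  have shift : ∀ X : F, ∑ Y : F,
      (if X ^ 3 + a ^ 2 * X ^ 2 + (Y ^ 3 + b ^ 2 * Y ^ 2) = 1 then (1 : ℤ) else 0) =
      ∑ t : F, if (t + a ^ 2 + b ^ 2) * X ^ 2 + t ^ 2 * X + (t ^ 3 + b ^ 2 * t ^ 2 + 1) = 0
        then (1 : ℤ) else 0 := by
    intro X
    refine (Fintype.sum_equiv (Equiv.addLeft X) _ _ fun t => ?_).symm
    congr 1
    simp only [Equiv.coe_addLeft, eq_iff_iff]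
    constructor <;> intro h <;> grind
  simp_rw [shift]
  rw [Finset.sum_comm]
  set P : F → F := fun s =>
    1 + a ^ 2 * s + (a ^ 2 * b ^ 2 + b ^ 4) * s ^ 2 + s ^ 3 + (a ^ 2 + b ^ 2) * s ^ 4 with hP
  have slice : ∀ t : F, ∑ X : F,
      (if (t + a ^ 2 + b ^ 2) * X ^ 2 + t ^ 2 * X + (t ^ 3 + b ^ 2 * t ^ 2 + 1) = 0
        then (1 : ℤ) else 0) =
      1 + χ (P t⁻¹) - (if t = a ^ 2 + b ^ 2 then 1 else 0) + if t = 0 then 1 else 0 := by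
    intro t
    rcases eq_or_ne t 0 with rfl | ht
    · have hP0 : χ (P 0⁻¹) = -1 := by simp [hP, h.map_one]
      rw [hP0]
      by_cases hd : a ^ 2 + b ^ 2 = 0
      · simp [hd]
      · have : ∀ X : F, (0 + a ^ 2 + b ^ 2) * X ^ 2 + 0 ^ 2 * X + (0 ^ 3 + b ^ 2 * 0 ^ 2 + 1) = 0 ↔
            X = (a + b)⁻¹ := by
          intro X
          have hs : a ^ 2 + b ^ 2 = (a + b) ^ 2 := by grind
          have hab : a + b ≠ 0 := fun h0 => hd (by rw [hs, h0]; simp)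
          have h1 : (0 + a ^ 2 + b ^ 2) * X ^ 2 + 0 ^ 2 * X + (0 ^ 3 + b ^ 2 * 0 ^ 2 + 1) =
              ((a + b) * X + 1) ^ 2 := by grind
          rw [h1, sq_eq_zero_iff, CharTwo.add_eq_zero, inv_eq_one_div, eq_div_iff hab, mul_comm]
        simp only [this, Finset.sum_ite_eq', Finset.mem_univ, if_true]
        simp [Ne.symm hd]
    · rw [h.sum_quadratic ht]
      have h1 : (t + a ^ 2 + b ^ 2) * (t ^ 3 + b ^ 2 * t ^ 2 + 1) / t ^ 4 = P t⁻¹ := by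
        simp only [hP]
        field_simp
        grind
      have h2 : t + a ^ 2 + b ^ 2 = 0 ↔ t = a ^ 2 + b ^ 2 := by
        rw [add_assoc, CharTwo.add_eq_zero]
      simp [h1, h2, ht]
  have invert : ∑ t, χ (P t⁻¹) = ∑ s, χ (P s) := Equiv.sum_comp (Equiv.inv F) (fun s => χ (P s))
  simp_rw [slice]
  rw [Finset.sum_add_distrib, Finset.sum_sub_distrib, Finset.sum_add_distrib, Finset.sum_ite_eq',
    Finset.sum_ite_eq', invert,
    ← Equiv.sum_comp (Equiv.addRight (a + b)) (fun s => χ (P s)), h.cubicSum_cube, Finset.mul_sum]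
  have h3 : ∀ v, χ (P (v + (a + b))) = -(χ (a ^ 3 + b ^ 3) * χ (v ^ 3 + a * b * v)) := by
    intro v
    have : P (v + (a + b)) = 1 + (v ^ 3 + a * b * v) + (a ^ 3 + b ^ 3) +
        (((a + b) * v ^ 2 + b ^ 2 * v + a * b * v + a ^ 3 + a * b ^ 2) ^ 2 +
          ((a + b) * v ^ 2 + b ^ 2 * v + a * b * v + a ^ 3 + a * b ^ 2)) := by
      simp only [hP]
      grind
    rw [this, AddChar.map_add_eq_mul, h.map_sq_add, AddChar.map_add_eq_mul, AddChar.map_add_eq_mul,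
      h.map_one]
    ring
  simp only [Equiv.coe_addRight, h3]
  simp
  ring

/-- The convolution identity that makes `cubicSum` a Bessel function. -/
theorem sum_char_mul_cubicSum_mul (h : IsTraceChar χ) {m l : F} (hm : m ≠ 0) (hl : l ≠ 0) :
    ∑ ν, χ ν * (cubicSum χ (m * ν) * cubicSum χ (l * ν)) =
      -(Fintype.card F * (χ (m + l) * cubicSum χ (m * l))) := by
  obtain ⟨q, hq⟩ : ∃ q : ℤ, q = Fintype.card F := ⟨_, rfl⟩
  obtain ⟨a, rfl⟩ := h.exists_cube_eq m
  obtain ⟨b, rfl⟩ := h.exists_cube_eq l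
  have ha : a ≠ 0 := by rintro rfl; simp at hm
  have hb : b ≠ 0 := by rintro rfl; simp at hl
  set E : F → F → F := fun u v =>
    1 + (a ^ 6 * (u ^ 3 + u ^ 2) + b ^ 6 * (v ^ 3 + v ^ 2)) with hE
  have term : ∀ ν, χ ν * (cubicSum χ (a ^ 3 * ν) * cubicSum χ (b ^ 3 * ν)) =
      (∑ u, ∑ v, χ (E u v * ν ^ 2)) - if ν = 0 then q ^ 2 else 0 := by
    intro ν
    rcases eq_or_ne ν 0 with rfl | hν
    · simp [h.cubicSum_zero, hq, sq]
    · rw [cubicSum_eq (mul_ne_zero hm hν), cubicSum_eq (mul_ne_zero hl hν), Finset.sum_mul_sum,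
        Finset.mul_sum]
      simp only [hν, if_false, sub_zero]
      refine Finset.sum_congr rfl fun u _ => ?_
      rw [Finset.mul_sum]
      refine Finset.sum_congr rfl fun v _ => ?_
      rw [← AddChar.map_add_eq_mul, ← AddChar.map_add_eq_mul,
        ← mul_one (χ (E u v * ν ^ 2)), ← h.map_sq_add (ν * (a ^ 3 * u + b ^ 3 * v + 1)),
        ← AddChar.map_add_eq_mul]
      congr 1
      simp only [hE]
      grind
  simp_rw [term]
  rw [Finset.sum_sub_distrib, Finset.sum_comm]
  simp_rw [Finset.sum_comm (s := (Finset.univ : Finset F)) (t := Finset.univ)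
    (f := fun ν v => χ (E _ v * ν ^ 2)), h.sum_mul_sq]
  have count : ∑ u, ∑ v, (if E u v = 0 then (1 : ℤ) else 0) =
      q - χ (a ^ 3 + b ^ 3) * cubicSum χ ((a * b) ^ 3) := by
    rw [hq, ← h.sum_plane_cubic]
    refine Fintype.sum_bijective (fun x => a ^ 2 * x) (mulLeft_bijective₀ _ (pow_ne_zero 2 ha))
      _ _ fun u => ?_
    refine Fintype.sum_bijective (fun x => b ^ 2 * x) (mulLeft_bijective₀ _ (pow_ne_zero 2 hb))
      _ _ fun v => ?_
    congr 1
    rw [hE, CharTwo.add_eq_zero, eq_iff_iff, eq_comm]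
    ring_nf
  have scale : ∀ u v, (if E u v = 0 then q else 0) = q * if E u v = 0 then (1 : ℤ) else 0 := by
    intro u v
    split_ifs <;> simp
  simp_rw [← hq, scale, ← Finset.mul_sum, count, Finset.sum_ite_eq', Finset.mem_univ, if_true,
    mul_pow]
  ring

theorem sum_fourier_mul_mul (h : IsTraceChar χ) (f g k : F → ℤ) :
    ∑ t, (∑ μ, χ (μ * t) * f μ) * (∑ ν, χ (ν * t) * g ν) * (∑ l, χ (l * t) * k l) =
      Fintype.card F * ∑ μ, ∑ ν, f μ * g ν * k (μ + ν) := by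
  have expand : ∀ t, (∑ μ, χ (μ * t) * f μ) * (∑ ν, χ (ν * t) * g ν) * (∑ l, χ (l * t) * k l) =
      ∑ μ, ∑ ν, ∑ l, f μ * g ν * k l * χ (t * (μ + ν + l)) := by
    intro t
    rw [Finset.sum_mul_sum, Finset.sum_mul]
    refine Finset.sum_congr rfl fun μ _ => ?_
    rw [Finset.sum_mul]
    refine Finset.sum_congr rfl fun ν _ => ?_
    rw [Finset.mul_sum]
    refine Finset.sum_congr rfl fun l _ => ?_
    rw [show t * (μ + ν + l) = μ * t + ν * t + l * t by ring, AddChar.map_add_eq_mul,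
      AddChar.map_add_eq_mul]
    ring
  simp_rw [expand]
  rw [Finset.sum_comm, Finset.mul_sum]
  refine Finset.sum_congr rfl fun μ _ => ?_
  rw [Finset.sum_comm, Finset.mul_sum]
  refine Finset.sum_congr rfl fun ν _ => ?_
  rw [Finset.sum_comm]
  simp_rw [← Finset.mul_sum, h.sum_mul, CharTwo.add_eq_zero, mul_ite, mul_zero,
    Finset.sum_ite_eq, Finset.mem_univ, if_true]
  ring

omit [DecidableEq F] in
theorem cubicSum_mul_cube (h : IsTraceChar χ) {c : F} (hc : c ≠ 0) (ρ : F) :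
    cubicSum χ (c * ρ ^ 3) = ∑ u, χ (u * ρ) * χ (u ^ 3 / c) := by
  rcases eq_or_ne ρ 0 with rfl | hρ
  · have := h.sum_mul_cube (inv_ne_zero hc)
    simp [h.cubicSum_zero, div_eq_inv_mul, this]
  · symm
    refine Fintype.sum_bijective (fun x => ρ * x) (mulLeft_bijective₀ ρ hρ) _ _ fun u => ?_
    rw [← AddChar.map_add_eq_mul]
    congr 1
    field_simp

theorem cubicSum_sq_le (h : IsTraceChar χ) (c : F) :
    cubicSum χ c ^ 2 ≤ 2 * Fintype.card F := by
  obtain ⟨ρ, rfl⟩ := h.exists_cube_eq c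
  have shift : ∀ u, ∑ v, χ (u ^ 3 + ρ * u) * χ (v ^ 3 + ρ * v) =
      ∑ z, χ (z ^ 3 + ρ * z) * χ ((z + z ^ 4) * u ^ 2) := by
    intro u
    refine (Fintype.sum_equiv (Equiv.addLeft u) _ _ fun z => ?_).symm
    rw [Equiv.coe_addLeft, ← AddChar.map_add_eq_mul, ← AddChar.map_add_eq_mul,
      ← mul_one (χ (z ^ 3 + ρ * z + _)), ← h.map_sq_add (u * z ^ 2), ← AddChar.map_add_eq_mul]
    congr 1
    grind
  have h1 : ∀ z : F, z + z ^ 4 = 0 ↔ z = 0 ∨ z = 1 := by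
    intro z
    have h2 : z ^ 3 = 1 ↔ z = 1 := by
      simpa using h.cube_injective.eq_iff (a := z) (b := 1)
    rw [show z + z ^ 4 = z * (z ^ 3 + 1) by ring, mul_eq_zero, CharTwo.add_eq_zero, h2]
  rw [sq, h.cubicSum_cube, Finset.sum_mul_sum]
  simp_rw [shift]
  rw [Finset.sum_comm]
  simp_rw [← Finset.mul_sum, h.sum_mul_sq, h1]
  rw [← Finset.sum_filter_add_sum_filter_not _ fun z : F => z = 0 ∨ z = 1,
    show (Finset.univ.filter fun z : F => z = 0 ∨ z = 1) = {0, 1} by ext; simp,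
    Finset.sum_pair zero_ne_one, Finset.sum_eq_zero (s := Finset.univ.filter _)]
  · have hq : (0 : ℤ) ≤ Fintype.card F := by positivity
    rcases char_eq_one_or χ (1 ^ 3 + ρ * 1) with h3 | h3 <;> simp_all
    linarith
  · intro z hz
    rw [if_neg (by simpa using hz), mul_zero]

end IsTraceChar

/-- The Walsh-type sum `∑ χ(μ y) J(μ σ(μ))` of the cubic sums `J` along the norm form. -/
def walshSum (χ : AddChar F ℤ) (σ : F ≃+* F) (y : F) : ℤ :=
  ∑ μ : F, χ (μ * y) * cubicSum χ (μ * σ μ)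

namespace IsTraceGen

variable {σ : F ≃+* F}

omit [DecidableEq F] [CharP F 2] in
theorem sum_comp_norm (g : IsTraceGen χ σ) (f : F → ℤ) : ∑ x, f (x * σ x) = ∑ x, f x :=
  Fintype.sum_bijective _ (Finite.injective_iff_bijective.mp g.norm_injective) _ _ fun _ => rfl

theorem walshSum_param (g : IsTraceGen χ σ) (h : IsTraceChar χ) {κ : F} (hκ : κ ≠ 0) :
    walshSum χ σ ((σ (σ κ) + κ) / σ κ) = -(Fintype.card F * χ (κ * σ κ)⁻¹) := by
  obtain ⟨q, hq⟩ : ∃ q : ℤ, q = Fintype.card F := ⟨_, rfl⟩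
  have hq0 : q ≠ 0 := by rw [hq]; exact_mod_cast Fintype.card_ne_zero
  have hσκ : σ κ ≠ 0 := by simpa using hκ
  have hσσκ : σ (σ κ) ≠ 0 := by simpa using hκ
  obtain ⟨a, ha⟩ : ∃ a, a = σ (σ κ) / σ κ := ⟨_, rfl⟩
  have ha0 : a ≠ 0 := by rw [ha]; exact div_ne_zero hσσκ hσκ
  have expand : ∀ μ, q * (χ (μ * ((σ (σ κ) + κ) / σ κ)) * cubicSum χ (μ * σ μ)) =
      -∑ ν, χ ν * (cubicSum χ (a * ν * μ) * cubicSum χ (σ.symm (ν / a) * μ)) := by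
    intro μ
    rcases eq_or_ne μ 0 with rfl | hμ
    · simp [h.cubicSum_zero]
    have hσμ : σ μ ≠ 0 := by simpa using hμ
    have h1 : ∀ ν, cubicSum χ (σ.symm (ν / a) * μ) = cubicSum χ (σ μ / a * ν) := by
      intro ν
      rw [← cubicSum_map g.map_char]
      simp only [map_mul, RingEquiv.apply_symm_apply]
      congr 1
      ring
    have h2 : χ (μ * ((σ (σ κ) + κ) / σ κ)) = χ (a * μ + σ μ / a) := by
      have h3 : σ μ / a = σ (μ * κ / σ κ) := by
        simp only [map_mul, map_div₀, ha]
        field_simp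
      rw [AddChar.map_add_eq_mul, h3, g.map_char, ← AddChar.map_add_eq_mul, ha]
      congr 1
      ring
    have h4 := h.sum_char_mul_cubicSum_mul (mul_ne_zero ha0 hμ) (div_ne_zero hσμ ha0)
    rw [show a * μ * (σ μ / a) = μ * σ μ by field_simp, ← h2, ← hq] at h4
    simp_rw [h1, mul_right_comm a _ μ, h4, neg_neg]
  have hν : ∀ ν, ν ≠ 0 → (a * ν = σ.symm (ν / a) ↔ ν = σ (κ * σ κ)⁻¹) := by
    intro ν hν0
    rw [RingEquiv.eq_symm_apply, map_mul, eq_div_iff ha0]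
    constructor
    · intro he
      have hfix : σ (ν * (σ κ * σ (σ κ))) = ν * (σ κ * σ (σ κ)) := by
        have h3 : σ (σ (σ κ)) ≠ 0 := by simpa using hκ
        simp only [ha, map_div₀] at he
        field_simp at he
        simp only [map_mul]
        linear_combination (σ (σ κ)) * he
      rcases g.fixed _ hfix with h0 | h1
      · simp_all
      · simp only [map_inv₀, map_mul]
        exact eq_inv_of_mul_eq_one_left h1
    · rintro rfl
      simp only [ha, map_inv₀, map_mul, map_div₀]
      have h3 : σ (σ (σ κ)) ≠ 0 := by simpa using hκ
      field_simp
  have inner : ∀ ν, ∑ μ, cubicSum χ (a * ν * μ) * cubicSum χ (σ.symm (ν / a) * μ) =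
      if ν = σ (κ * σ κ)⁻¹ then q ^ 2 else 0 := by
    intro ν
    rcases eq_or_ne ν 0 with rfl | hν0
    · have : (0 : F) ≠ σ (κ * σ κ)⁻¹ := by simpa using hκ
      simp [h.cubicSum_zero, hκ]
    · rw [h.sum_cubicSum_mul (mul_ne_zero ha0 hν0) (by simpa using ⟨hν0, ha0⟩), hq]
      simp only [hν ν hν0]
  apply mul_left_cancel₀ hq0
  rw [walshSum, Finset.mul_sum]
  simp_rw [expand]
  rw [Finset.sum_neg_distrib, Finset.sum_comm]
  simp_rw [← Finset.mul_sum, inner, mul_ite, mul_zero, Finset.sum_ite_eq', Finset.mem_univ,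
    if_true, g.map_char, hq]
  ring

omit [CharP F 2] in
theorem sum_walshSum (h : IsTraceChar χ) (σ : F ≃+* F) : ∑ y, walshSum χ σ y = 0 := by
  simp only [walshSum]
  rw [Finset.sum_comm]
  refine Finset.sum_eq_zero fun μ _ => ?_
  rcases eq_or_ne μ 0 with rfl | hμ
  · simp [h.cubicSum_zero]
  · simp_rw [← Finset.sum_mul, mul_comm μ, h.sum_mul]
    simp [hμ]

theorem sum_cubicSum_norm_sq (g : IsTraceGen χ σ) (h : IsTraceChar χ) :
    ∑ μ, cubicSum χ (μ * σ μ) ^ 2 = (Fintype.card F : ℤ) ^ 2 := by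
  rw [g.sum_comp_norm fun c => cubicSum χ c ^ 2]
  simpa [sq] using h.sum_cubicSum_mul one_ne_zero one_ne_zero

theorem sum_walshSum_mul_shift (h : IsTraceChar χ) (σ : F ≃+* F) (b : F) :
    ∑ y, walshSum χ σ y * walshSum χ σ (y + b) =
      Fintype.card F * ∑ μ, χ (μ * b) * cubicSum χ (μ * σ μ) ^ 2 := by
  have expand : ∀ y, walshSum χ σ y * walshSum χ σ (y + b) = ∑ μ, ∑ ν,
      χ (ν * b) * cubicSum χ (μ * σ μ) * cubicSum χ (ν * σ ν) * χ (y * (μ + ν)) := by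
    intro y
    rw [walshSum, walshSum, Finset.sum_mul_sum]
    refine Finset.sum_congr rfl fun μ _ => Finset.sum_congr rfl fun ν _ => ?_
    rw [mul_add, mul_add, AddChar.map_add_eq_mul, AddChar.map_add_eq_mul, mul_comm y, mul_comm y]
    ring
  simp_rw [expand]
  rw [Finset.sum_comm, Finset.mul_sum]
  refine Finset.sum_congr rfl fun μ _ => ?_
  rw [Finset.sum_comm]
  simp_rw [← Finset.mul_sum, h.sum_mul, CharTwo.add_eq_zero, mul_ite, mul_zero, Finset.sum_ite_eq,
    Finset.mem_univ, if_true]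
  ring

theorem sum_walshSum_sq (g : IsTraceGen χ σ) (h : IsTraceChar χ) :
    ∑ y, walshSum χ σ y ^ 2 = (Fintype.card F : ℤ) ^ 3 := by
  have := sum_walshSum_mul_shift h σ 0
  simp only [add_zero, mul_zero, AddChar.map_zero_eq_one, one_mul, ← sq] at this
  rw [this, g.sum_cubicSum_norm_sq h]
  ring

/-- The parameters `κ` giving the points where `walshSum` is positive. -/
def params (χ : AddChar F ℤ) (σ : F ≃+* F) : Finset F :=
  Finset.univ.filter fun κ => χ (κ * σ κ)⁻¹ = -1

omit [DecidableEq F] [CharP F 2] in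
theorem mem_params {κ : F} : κ ∈ params χ σ ↔ χ (κ * σ κ)⁻¹ = -1 := by
  simp [params]

omit [DecidableEq F] [CharP F 2] in
theorem ne_zero_of_mem_params {κ : F} (hκ : κ ∈ params χ σ) : κ ≠ 0 := by
  rintro rfl
  simp [mem_params] at hκ

omit [DecidableEq F] in
theorem two_mul_card_params (g : IsTraceGen χ σ) (h : IsTraceChar χ) :
    2 * ((params χ σ).card : ℤ) = Fintype.card F := by
  have h1 : ∀ κ, 1 - χ (κ * σ κ)⁻¹ = if χ (κ * σ κ)⁻¹ = -1 then (2 : ℤ) else 0 := by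
    intro κ
    rcases char_eq_one_or χ (κ * σ κ)⁻¹ with h1 | h1 <;> rw [h1] <;> norm_num
  have h2 : ∑ κ, (1 - χ (κ * σ κ)⁻¹) = Fintype.card F := by
    have h3 : ∑ x, χ x⁻¹ = ∑ x, χ x := Equiv.sum_comp (Equiv.inv F) χ
    rw [Finset.sum_sub_distrib, g.sum_comp_norm fun x => χ x⁻¹, h3, h.sum_eq_zero]
    simp
  rw [← h2]
  simp_rw [h1]
  rw [← Finset.sum_filter, Finset.sum_const, params]
  simp [mul_comm]

omit [Fintype F] [DecidableEq F] in
theorem char_map_add_self (g : IsTraceGen χ σ) (w : F) : χ (σ w + w) = 1 := by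
  rw [AddChar.map_add_eq_mul, g.map_char, char_mul_self]

omit [DecidableEq F] in
theorem param_injOn (g : IsTraceGen χ σ) :
    Set.InjOn (fun κ => (σ (σ κ) + κ) / σ κ) (params χ σ) := by
  intro k hk l hl hkl
  have hk0 := ne_zero_of_mem_params hk
  have hl0 := ne_zero_of_mem_params hl
  have hσk : σ k ≠ 0 := by simpa using hk0
  have hσl : σ l ≠ 0 := by simpa using hl0
  have hkl : (σ (σ k) + k) / σ k = (σ (σ l) + l) / σ l := hkl
  rw [div_eq_div_iff hσk hσl] at hkl
  have hfix : σ (k * σ l + l * σ k) = k * σ l + l * σ k := by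
    simp only [map_add, map_mul]
    grind
  rcases g.fixed _ hfix with h0 | h1
  · have h2 : σ (k / l) = k / l := by
      rw [CharTwo.add_eq_zero] at h0
      rw [map_div₀, div_eq_div_iff hσl hl0, h0, mul_comm]
    rcases g.fixed _ h2 with h3 | h3
    · simp [hk0, hl0] at h3
    · exact (div_eq_one_iff_eq hl0).mp h3
  · have h2 : (k * σ k)⁻¹ = σ (l / k) + l / k := by
      rw [map_div₀]
      field_simp
      rw [← h1]
      ring
    have h3 := mem_params.mp hk
    rw [h2, g.char_map_add_self] at h3
    norm_num at h3

theorem walshSum_eq (g : IsTraceGen χ σ) (h : IsTraceChar χ) (y : F) :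
    walshSum χ σ y = if ∃ κ ∈ params χ σ, (σ (σ κ) + κ) / σ κ = y then (Fintype.card F : ℤ)
      else -Fintype.card F := by
  obtain ⟨q, hq⟩ : ∃ q : ℤ, q = Fintype.card F := ⟨_, rfl⟩
  set T := (params χ σ).image fun κ => (σ (σ κ) + κ) / σ κ with hT
  have onT : ∀ y ∈ T, walshSum χ σ y = q := by
    intro y hy
    obtain ⟨κ, hκ, rfl⟩ := Finset.mem_image.mp hy
    rw [g.walshSum_param h (ne_zero_of_mem_params hκ), mem_params.mp hκ, hq]
    ring
  have cardT : 2 * (T.card : ℤ) = q := by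
    rw [hT, Finset.card_image_of_injOn g.param_injOn, hq, g.two_mul_card_params h]
  have total : ∑ y, (walshSum χ σ y + q) ^ 2 = 2 * q ^ 3 := by
    simp_rw [add_sq]
    rw [Finset.sum_add_distrib, Finset.sum_add_distrib, g.sum_walshSum_sq h, ← Finset.sum_mul,
      ← Finset.mul_sum, sum_walshSum h]
    simp [← hq]
    ring
  have partT : ∑ y ∈ T, (walshSum χ σ y + q) ^ 2 = 2 * q ^ 3 := by
    rw [Finset.sum_congr rfl fun y hy => by rw [onT y hy], Finset.sum_const, nsmul_eq_mul]
    linear_combination (2 * q ^ 2) * cardT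
  have offT : ∑ y ∈ Tᶜ, (walshSum χ σ y + q) ^ 2 = 0 := by
    have := Finset.sum_add_sum_compl T fun y => (walshSum χ σ y + q) ^ 2
    rw [total, partT] at this
    linarith
  rw [Finset.sum_eq_zero_iff_of_nonneg fun _ _ => sq_nonneg _] at offT
  rw [← hq]
  split_ifs with hy
  · exact onT y (by simpa [hT] using hy)
  · have := offT y (by simpa [hT] using hy)
    exact eq_neg_of_add_eq_zero_left (pow_eq_zero_iff two_ne_zero |>.mp this)

/-- Additive Hilbert 90 for `σ`: `χ` detects the image of `w ↦ σ w + w`. -/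
theorem exists_map_add_self_eq (g : IsTraceGen χ σ) (h : IsTraceChar χ) {a : F} (ha : χ a = 1) :
    ∃ w, σ w + w = a := by
  have hq : (Fintype.card F : ℤ) ≠ 0 := by exact_mod_cast Fintype.card_ne_zero
  by_contra! hne
  have h1 : ∑ w, (Fintype.card F : ℤ) * (if σ w + w + a = 0 then 1 else 0) = 0 :=
    Finset.sum_eq_zero fun w _ => by simp [CharTwo.add_eq_zero, hne w]
  simp_rw [h.mul_indicator] at h1
  rw [Finset.sum_comm] at h1
  have inner : ∀ l : F, ∑ w, χ (l * (σ w + w + a)) =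
      if l = 0 ∨ l = 1 then (Fintype.card F : ℤ) * χ (l * a) else 0 := by
    intro l
    have h2 : ∀ w, χ (l * (σ w + w + a)) = χ (l * a) * χ (σ w * (l + σ l)) := by
      intro w
      rw [show σ w * (l + σ l) = l * σ w + σ (l * w) by rw [map_mul]; ring,
        AddChar.map_add_eq_mul _ (l * σ w), g.map_char, ← AddChar.map_add_eq_mul,
        ← AddChar.map_add_eq_mul]
      congr 1
      ring
    have h3 : ∑ w, χ (σ w * (l + σ l)) = ∑ w, χ (w * (l + σ l)) :=
      Equiv.sum_comp σ.toEquiv fun w => χ (w * (l + σ l))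
    have h4 : l + σ l = 0 ↔ l = 0 ∨ l = 1 := by
      rw [CharTwo.add_eq_zero]
      refine ⟨fun h5 => g.fixed l h5.symm, ?_⟩
      rintro (rfl | rfl) <;> simp
    simp_rw [h2]
    rw [← Finset.mul_sum, h3, h.sum_mul]
    simp only [h4]
    split_ifs <;> ring
  simp_rw [inner] at h1
  rw [Finset.sum_ite, Finset.sum_const_zero, add_zero,
    show (Finset.univ.filter fun l : F => l = 0 ∨ l = 1) = {0, 1} by ext; simp,
    Finset.sum_pair zero_ne_one] at h1
  simp [ha] at h1

omit [Fintype F] [DecidableEq F] in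
theorem param_norm {P : F → F} (hP : ∀ x, P x * σ x = x * σ (σ x)) (hP0 : P 0 = 0) {l m y : F}
    (hlm : l * σ l + m * σ m = 1) (hne : l + m ≠ 0)
    (hy : y = (σ (σ (l + m)) + (l + m)) / σ (l + m)) :
    y * σ y = P (l * σ l) + P (m * σ m) + 1 := by
  have hPn : ∀ z, P (z * σ z) = z * σ (σ (σ z)) := by
    intro z
    rcases eq_or_ne z 0 with rfl | hz
    · simp [hP0]
    · have h1 : σ (z * σ z) ≠ 0 := by simpa using hz
      apply mul_right_cancel₀ h1
      rw [hP]
      simp only [map_mul]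
      ring
  have hσ : σ (l + m) ≠ 0 := (map_ne_zero σ).mpr hne
  have e1 := congrArg σ hlm
  have e2 := congrArg σ e1
  rw [eq_div_iff hσ] at hy
  simp only [map_add, map_mul, map_one] at e1 e2 hy hσ
  have hl : l + σ (σ l) = y * σ m := by
    apply mul_right_cancel₀ hσ
    grind
  have hm : m + σ (σ m) = y * σ l := by
    apply mul_right_cancel₀ hσ
    grind
  have hl' := congrArg σ hl
  have hm' := congrArg σ hm
  simp only [map_add, map_mul] at hl' hm'
  rw [hPn, hPn]
  have h1 : y * σ y = (y * σ m) * (σ y * σ (σ m)) + (y * σ l) * (σ y * σ (σ l)) := by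
    linear_combination (-(y * σ y)) * e1
  rw [h1, ← hl, ← hm, ← hl', ← hm']
  grind

theorem exists_param_iff (g : IsTraceGen χ σ) (h : IsTraceChar χ) {P : F → F}
    (hP : ∀ x, P x * σ x = x * σ (σ x)) (hP0 : P 0 = 0) (y : F) :
    (∃ κ ∈ params χ σ, (σ (σ κ) + κ) / σ κ = y) ↔ ∃ x, y * σ y = P (x + 1) + P x + 1 := by
  have hsurj : Function.Surjective fun x => x * σ x :=
    (Finite.injective_iff_bijective.mp g.norm_injective).2
  constructor
  · rintro ⟨κ, hκ, rfl⟩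
    have hκ0 := ne_zero_of_mem_params hκ
    have hσκ0 : σ κ ≠ 0 := by simpa using hκ0
    obtain ⟨w, hw⟩ := g.exists_map_add_self_eq h (a := 1 + (κ * σ κ)⁻¹) (by
      rw [AddChar.map_add_eq_mul, h.map_one, mem_params.mp hκ]; norm_num)
    have hw' : (1 + σ w + w) * (κ * σ κ) = 1 := by
      rw [add_assoc, hw]
      field_simp
      grind
    have hs : w * κ + (w + 1) * κ = κ := by grind
    have hlm : (w * κ) * σ (w * κ) + ((w + 1) * κ) * σ ((w + 1) * κ) = 1 := by
      simp only [map_mul, map_add, map_one]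
      grind
    refine ⟨((w + 1) * κ) * σ ((w + 1) * κ), ?_⟩
    rw [param_norm hP hP0 hlm (by rwa [hs]) (by rw [hs])]
    congr 3
    exact (CharTwo.add_eq_iff_eq_add.mp hlm).trans (add_comm _ _)
  · rintro ⟨x, hx⟩
    obtain ⟨l, hl⟩ := hsurj (x + 1)
    obtain ⟨m, hm⟩ := hsurj x
    simp only at hl hm
    have hlm : l * σ l + m * σ m = 1 := by grind
    have hne : l + m ≠ 0 := by
      intro h0
      rw [CharTwo.add_eq_zero] at h0
      subst h0
      rw [CharTwo.add_self_eq_zero] at hlm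
      exact zero_ne_one hlm
    have hσne : σ (l + m) ≠ 0 := (map_ne_zero σ).mpr hne
    refine ⟨l + m, ?_, g.norm_injective ?_⟩
    · have hc : ((l + m) * σ (l + m))⁻¹ = σ (l / (l + m)) + l / (l + m) + 1 := by
        rw [map_div₀]
        field_simp
        simp only [map_add]
        grind
      rw [mem_params, hc, AddChar.map_add_eq_mul, g.char_map_add_self, h.map_one, one_mul]
    · simp only
      rw [hx, param_norm hP hP0 hlm hne rfl, hl, hm]

theorem sum_cubicSum_norm_triple (g : IsTraceGen χ σ) (h : IsTraceChar χ) {α β : F} (hα : α ≠ 0)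
    (hβ : β ≠ 0) (hne : α ≠ β) :
    ∑ τ, cubicSum χ (α * τ * σ (α * τ)) * cubicSum χ (β * τ * σ (β * τ)) *
      cubicSum χ ((α + β) * τ * σ ((α + β) * τ)) = 0 := by
  have hγ : α + β ≠ 0 := fun h0 => hne (CharTwo.add_eq_zero.mp h0)
  have hσα : σ α ≠ 0 := (map_ne_zero σ).mpr hα
  have hσβ : σ β ≠ 0 := (map_ne_zero σ).mpr hβ
  have hσγ : σ α + σ β ≠ 0 := by rw [← map_add]; exact (map_ne_zero σ).mpr hγ
  have hdet : σ α * β + α * σ β ≠ 0 := by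
    intro h0
    rw [CharTwo.add_eq_zero] at h0
    have h2 : σ (α / β) = α / β := by
      rw [map_div₀, div_eq_div_iff hσβ hβ, h0]
    rcases g.fixed _ h2 with h3 | h3
    · simp [hα, hβ] at h3
    · exact hne ((div_eq_one_iff_eq hβ).mp h3)
  have split : ∀ δ τ : F, δ * τ * σ (δ * τ) = δ * σ δ * (τ * σ τ) := by
    intro δ τ
    rw [map_mul]
    ring
  simp_rw [split]
  rw [g.sum_comp_norm fun ν => cubicSum χ (α * σ α * ν) * cubicSum χ (β * σ β * ν) *
    cubicSum χ ((α + β) * σ (α + β) * ν), ← h.sum_comp_cube]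
  simp_rw [map_add, h.cubicSum_mul_cube (mul_ne_zero hα hσα),
    h.cubicSum_mul_cube (mul_ne_zero hβ hσβ), h.cubicSum_mul_cube (mul_ne_zero hγ hσγ)]
  rw [h.sum_fourier_mul_mul, mul_eq_zero]
  right
  obtain ⟨c, hc⟩ : ∃ c, c = ((σ α * β + α * σ β) * (α * β * (α + β)))⁻¹ := ⟨_, rfl⟩
  obtain ⟨d, hd⟩ : ∃ d, d = ((σ α * β + α * σ β) * (σ α * σ β * (σ α + σ β)))⁻¹ := ⟨_, rfl⟩
  have hc0 : c ≠ 0 := by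
    rw [hc]
    exact inv_ne_zero (mul_ne_zero hdet (mul_ne_zero (mul_ne_zero hα hβ) hγ))
  have diagonal : ∀ u v : F, χ (u ^ 3 / (α * σ α)) * χ (v ^ 3 / (β * σ β)) *
      χ ((u + v) ^ 3 / ((α + β) * (σ α + σ β))) =
      χ (c * (β * u + α * v) ^ 3) * χ (d * (σ β * u + σ α * v) ^ 3) := by
    intro u v
    rw [← AddChar.map_add_eq_mul, ← AddChar.map_add_eq_mul, ← AddChar.map_add_eq_mul]
    congr 1
    rw [hc, hd]
    field_simp
    grind
  simp_rw [diagonal]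
  rw [← Fintype.sum_prod_type' fun u v : F =>
    χ (c * (β * u + α * v) ^ 3) * χ (d * (σ β * u + σ α * v) ^ 3)]
  have hinj : Function.Injective fun p : F × F => (β * p.1 + α * p.2, σ β * p.1 + σ α * p.2) := by
    rintro ⟨u, v⟩ ⟨u', v'⟩ huv
    simp only [Prod.mk.injEq] at huv ⊢
    obtain ⟨e1, e2⟩ := huv
    constructor <;> apply mul_left_cancel₀ hdet <;> grind
  rw [Fintype.sum_bijective _ (Finite.injective_iff_bijective.mp hinj) _
    (fun p : F × F => χ (c * p.1 ^ 3) * χ (d * p.2 ^ 3)) fun _ => rfl,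
    Fintype.sum_prod_type' fun u v : F => χ (c * u ^ 3) * χ (d * v ^ 3)]
  simp_rw [← Finset.mul_sum, ← Finset.sum_mul]
  rw [h.sum_mul_cube hc0, zero_mul]

theorem sum_walshSum_triple (g : IsTraceGen χ σ) (h : IsTraceChar χ) {u v w : F} (huv : u ≠ v)
    (huw : u ≠ w) (hvw : v ≠ w) :
    ∑ x, ∑ t, walshSum χ σ (u * x + t) * walshSum χ σ (v * x + t) * walshSum χ σ (w * x + t) =
      0 := by
  have hα : v + w ≠ 0 := fun h0 => hvw (CharTwo.add_eq_zero.mp h0)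
  have hβ : u + w ≠ 0 := fun h0 => huw (CharTwo.add_eq_zero.mp h0)
  have hne : v + w ≠ u + w := fun h0 => huv (add_right_cancel h0).symm
  have shift : ∀ z x t, walshSum χ σ (z * x + t) =
      ∑ μ, χ (μ * t) * (χ (μ * (z * x)) * cubicSum χ (μ * σ μ)) := by
    intro z x t
    refine Finset.sum_congr rfl fun μ _ => ?_
    rw [mul_add, AddChar.map_add_eq_mul]
    ring
  have collect : ∀ x μ ν,
      χ (μ * (u * x)) * cubicSum χ (μ * σ μ) * (χ (ν * (v * x)) * cubicSum χ (ν * σ ν)) *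
        (χ ((μ + ν) * (w * x)) * cubicSum χ ((μ + ν) * σ (μ + ν))) =
      cubicSum χ (μ * σ μ) * cubicSum χ (ν * σ ν) * cubicSum χ ((μ + ν) * σ (μ + ν)) *
        χ (x * (μ * (u + w) + ν * (v + w))) := by
    intro x μ ν
    rw [show x * (μ * (u + w) + ν * (v + w)) = μ * (u * x) + ν * (v * x) + (μ + ν) * (w * x) by
      ring, AddChar.map_add_eq_mul, AddChar.map_add_eq_mul]
    ring
  simp_rw [shift, h.sum_fourier_mul_mul, collect]
  rw [← Finset.mul_sum, Finset.sum_comm]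
  simp_rw [Finset.sum_comm (s := (Finset.univ : Finset F)) (t := Finset.univ)
    (f := fun x ν => _ * χ (x * (_ * (u + w) + ν * (v + w)))), ← Finset.mul_sum, h.sum_mul]
  have solve : ∀ μ ν, μ * (u + w) + ν * (v + w) = 0 ↔ ν = μ * (u + w) / (v + w) := by
    intro μ ν
    rw [CharTwo.add_eq_zero, eq_div_iff hα, eq_comm]
  simp only [solve, mul_ite, mul_zero, Finset.sum_ite_eq', Finset.mem_univ, if_true]
  rw [mul_eq_zero]
  right
  rw [← Finset.sum_mul, mul_eq_zero]
  left
  rw [← g.sum_cubicSum_norm_triple h hα hβ hne]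
  refine (Fintype.sum_bijective (fun τ => (v + w) * τ) (mulLeft_bijective₀ _ hα) _ _
    fun τ => ?_).symm
  have h1 : (v + w) * τ * (u + w) / (v + w) = (u + w) * τ := by field_simp
  rw [h1, ← add_mul]

omit [CharP F 2] in
theorem sum_walshSum_pair (h : IsTraceChar χ) (σ : F ≃+* F) {u v : F} (huv : u ≠ v) :
    ∑ x, ∑ t, walshSum χ σ (u * x + t) * walshSum χ σ (v * x + t) = 0 := by
  have shift : ∀ x, ∑ t, walshSum χ σ (u * x + t) * walshSum χ σ (v * x + t) =
      ∑ t, walshSum χ σ t * walshSum χ σ ((v - u) * x + t) := by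
    intro x
    refine Fintype.sum_equiv (Equiv.addLeft (u * x)) _ _ fun t => ?_
    rw [Equiv.coe_addLeft]
    congr 2
    ring
  simp_rw [shift]
  rw [Finset.sum_comm]
  refine Finset.sum_eq_zero fun t _ => ?_
  rw [← Finset.mul_sum, Fintype.sum_bijective (fun x => (v - u) * x + t)
    ((Equiv.addRight t).bijective.comp (mulLeft_bijective₀ _ (sub_ne_zero.mpr huv.symm))) _
    (walshSum χ σ) fun _ => rfl, sum_walshSum h, mul_zero]

omit [CharP F 2] in
theorem sum_walshSum_shift (h : IsTraceChar χ) (σ : F ≃+* F) (u : F) :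
    ∑ x, ∑ t, walshSum χ σ (u * x + t) = 0 :=
  Finset.sum_eq_zero fun x _ =>
    (Equiv.sum_comp (Equiv.addLeft (u * x)) (walshSum χ σ)).trans (sum_walshSum h σ)

theorem eq_zero_of_walshSum_periodic (g : IsTraceGen χ σ) (h : IsTraceChar χ) {b : F}
    (hb : ∀ y, walshSum χ σ (y + b) = walshSum χ σ y) : b = 0 := by
  by_contra hb0
  obtain ⟨q, hq⟩ : ∃ q : ℤ, q = Fintype.card F := ⟨_, rfl⟩
  have hq0 : 0 < q := by rw [hq]; exact_mod_cast Fintype.card_pos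
  have h1 : ∑ μ, χ (μ * b) * cubicSum χ (μ * σ μ) ^ 2 = q ^ 2 := by
    have h2 := sum_walshSum_mul_shift h σ b
    simp_rw [hb, ← sq] at h2
    rw [g.sum_walshSum_sq h, ← hq] at h2
    apply mul_left_cancel₀ hq0.ne'
    rw [← h2]
    ring
  have h3 : ∀ μ, (1 + χ (μ * b)) * cubicSum χ (μ * σ μ) ^ 2 ≤
      (1 + χ (μ * b)) * (2 * q) - if μ = 0 then 4 * q else 0 := by
    intro μ
    rcases eq_or_ne μ 0 with rfl | hμ
    · simp [h.cubicSum_zero]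
      linarith
    · have h4 := h.cubicSum_sq_le (μ * σ μ)
      rw [if_neg hμ, sub_zero, hq]
      refine mul_le_mul_of_nonneg_left h4 ?_
      rcases char_eq_one_or χ (μ * b) with h5 | h5 <;> rw [h5] <;> norm_num
  have h6 := Finset.sum_le_sum fun μ (_ : μ ∈ (Finset.univ : Finset F)) => h3 μ
  rw [Finset.sum_sub_distrib, ← Finset.sum_mul, Finset.sum_add_distrib, h.sum_mul] at h6
  simp_rw [add_mul, one_mul] at h6
  rw [Finset.sum_add_distrib, h1, g.sum_cubicSum_norm_sq h] at h6
  simp [hb0, ← hq] at h6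
  nlinarith

end IsTraceGen

omit [DecidableEq F] [CharP F 2] in
/-- A half-size subset of a finite field that avoids `0` is not stable under a nontrivial
multiplication. -/
theorem eq_one_of_mul_mem_iff {G : Finset F} (hG : 2 * G.card = Fintype.card F) (h0 : 0 ∉ G)
    {a : F} (ha : a ≠ 0) (hmul : ∀ y, a * y ∈ G ↔ y ∈ G) : a = 1 := by
  have hprod : ∏ y ∈ G, (a * y) = ∏ y ∈ G, y := by
    refine Finset.prod_bij (fun y _ => a * y) (fun y hy => (hmul y).mpr hy)
      (fun x _ y _ hxy => mul_left_cancel₀ ha hxy) (fun y hy => ?_) fun y _ => rfl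
    refine ⟨a⁻¹ * y, ?_, mul_inv_cancel_left₀ ha y⟩
    rwa [← hmul, mul_inv_cancel_left₀ ha]
  rw [Finset.prod_mul_distrib, Finset.prod_const] at hprod
  have hne : ∏ y ∈ G, y ≠ 0 := Finset.prod_ne_zero_iff.mpr fun y hy hy0 => h0 (hy0 ▸ hy)
  have hpow : a ^ G.card = 1 := mul_right_cancel₀ hne (by rw [hprod, one_mul])
  rw [← FiniteField.pow_card a, ← hG, mul_comm, pow_mul, hpow, one_pow]

omit [CharP F 2] in
/-- An affine map that stabilizes a half-size subset of a finite field is a translation. -/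
theorem eq_one_of_affine_mem_iff {B : Finset F} (hB : 2 * B.card = Fintype.card F) {a b : F}
    (ha : a ≠ 0) (hmem : ∀ y, a * y + b ∈ B ↔ y ∈ B) : a = 1 := by
  by_contra hne
  obtain ⟨c, hc⟩ : ∃ c, a * c + b = c := by
    refine ⟨b / (1 - a), ?_⟩
    have : 1 - a ≠ 0 := sub_ne_zero.mpr (Ne.symm hne)
    field_simp
    ring
  have key : ∀ B' : Finset F, 2 * B'.card = Fintype.card F → c ∉ B' →
      (∀ y, a * y + b ∈ B' ↔ y ∈ B') → False := by
    intro B' hB' hcB hmem'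
    refine hne (eq_one_of_mul_mem_iff (G := B'.map (Equiv.subRight c).toEmbedding)
      (by rwa [Finset.card_map]) ?_ ha fun y => ?_)
    · simpa [sub_eq_zero] using hcB
    · simp only [Finset.mem_map_equiv, Equiv.subRight_symm_apply]
      rw [← hmem' (y + c)]
      have : a * (y + c) + b = a * y + c := by
        linear_combination hc
      rw [this]
  by_cases hcB : c ∈ B
  · refine key Bᶜ ?_ (by simpa using hcB) (fun y => by simpa using not_congr (hmem y))
    rw [Finset.card_compl]
    omega
  · exact key B hB hcB hmem

omit [CharP F 2] in
/-- If `B` has trivial stabilizer in the affine group, then the blocks of its orbit through three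
points correspond to the affine maps sending these points into `B`. -/
theorem card_affine_blocks {B : Finset F}
    (hB : ∀ a b : F, a ≠ 0 → (∀ y, a * y + b ∈ B ↔ y ∈ B) → a = 1 ∧ b = 0) (u v w : F) :
    Nat.card {S : Set F // (∃ a b : F, a ≠ 0 ∧ S = (fun x => a * x + b) '' (B : Set F)) ∧
      u ∈ S ∧ v ∈ S ∧ w ∈ S} =
    (Finset.univ.filter fun p : F × F =>
      p.1 ≠ 0 ∧ u * p.1 + p.2 ∈ B ∧ v * p.1 + p.2 ∈ B ∧ w * p.1 + p.2 ∈ B).card := by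
  have preimage : ∀ x t : F, x ≠ 0 →
      {z | z * x + t ∈ B} = (fun y => x⁻¹ * y + -(x⁻¹ * t)) '' (B : Set F) := by
    intro x t hx
    ext z
    simp only [Set.mem_ofPred_eq, Set.mem_image, Finset.mem_coe]
    constructor
    · intro hz
      refine ⟨_, hz, ?_⟩
      field_simp
      ring
    · rintro ⟨y, hy, rfl⟩
      convert hy using 1
      field_simp
      ring
  change Set.ncard {S : Set F | _} = _
  rw [← Set.ncard_coe_finset]
  symm
  refine Set.ncard_congr (fun p _ => {z | z * p.1 + p.2 ∈ B}) ?_ ?_ ?_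
  · rintro ⟨x, t⟩ hp
    simp only [Finset.coe_filter, Finset.mem_univ, true_and, Set.mem_ofPred_eq] at hp
    exact ⟨⟨x⁻¹, -(x⁻¹ * t), inv_ne_zero hp.1, preimage x t hp.1⟩, hp.2⟩
  · rintro ⟨x, t⟩ ⟨x', t'⟩ hp hp' heq
    simp only [Finset.coe_filter, Finset.mem_univ, true_and, Set.mem_ofPred_eq] at hp hp'
    have hx := hp.1
    have heq : ∀ z, z * x + t ∈ B ↔ z * x' + t' ∈ B := fun z => Set.ext_iff.mp heq z
    obtain ⟨h1, h2⟩ := hB (x' / x) (t' - x' / x * t) (div_ne_zero hp'.1 hx) fun y => by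
      rw [show x' / x * y + (t' - x' / x * t) = (y - t) / x * x' + t' by ring, ← heq,
        div_mul_cancel₀ _ hx, sub_add_cancel]
    rw [div_eq_one_iff_eq hx] at h1
    subst h1
    rw [div_self hx, one_mul, sub_eq_zero] at h2
    rw [h2]
  · rintro S ⟨⟨a, b, ha, rfl⟩, hu, hv, hw⟩
    have hS := preimage a⁻¹ (-(a⁻¹ * b)) (inv_ne_zero ha)
    rw [inv_inv, mul_neg, neg_neg, mul_inv_cancel_left₀ ha] at hS
    rw [← hS] at hu hv hw
    exact ⟨(a⁻¹, -(a⁻¹ * b)), by simpa using ⟨ha, hu, hv, hw⟩, hS⟩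

namespace IsTraceGen

variable {σ : F ≃+* F} {B : Finset F}

omit [CharP F 2] in
theorem two_mul_card_of_walshSum (h : IsTraceChar χ)
    (hB : ∀ y, walshSum χ σ y = if y ∈ B then -(Fintype.card F : ℤ) else Fintype.card F) :
    2 * B.card = Fintype.card F := by
  have hq0 : (Fintype.card F : ℤ) ≠ 0 := by exact_mod_cast Fintype.card_ne_zero
  have h1 := sum_walshSum h σ
  have h2 : ∀ y, walshSum χ σ y =
      Fintype.card F - if y ∈ B then 2 * (Fintype.card F : ℤ) else 0 := by
    intro y
    rw [hB]
    split_ifs <;> ring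
  simp_rw [h2] at h1
  rw [Finset.sum_sub_distrib, Finset.sum_ite_mem] at h1
  simp at h1
  have h3 : (Fintype.card F : ℤ) * (Fintype.card F) = Fintype.card F * (2 * B.card) := by
    linear_combination h1
  exact_mod_cast (mul_left_cancel₀ hq0 h3).symm

theorem card_affine_triples (g : IsTraceGen χ σ) (h : IsTraceChar χ)
    (hB : ∀ y, walshSum χ σ y = if y ∈ B then -(Fintype.card F : ℤ) else Fintype.card F)
    {u v w : F} (huv : u ≠ v) (huw : u ≠ w) (hvw : v ≠ w) :
    8 * (Finset.univ.filter fun p : F × F =>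
      p.1 ≠ 0 ∧ u * p.1 + p.2 ∈ B ∧ v * p.1 + p.2 ∈ B ∧ w * p.1 + p.2 ∈ B).card +
      4 * Fintype.card F = Fintype.card F ^ 2 := by
  obtain ⟨q, hq⟩ : ∃ q : ℤ, q = Fintype.card F := ⟨_, rfl⟩
  have hq0 : q ≠ 0 := by rw [hq]; exact_mod_cast Fintype.card_ne_zero
  have indicator : ∀ y, q - walshSum χ σ y = if y ∈ B then 2 * q else 0 := by
    intro y
    rw [hB, hq]
    split_ifs <;> ring
  have expand : ∑ x, ∑ t, (q - walshSum χ σ (u * x + t)) * (q - walshSum χ σ (v * x + t)) *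
      (q - walshSum χ σ (w * x + t)) = q ^ 5 := by
    have h1 : ∀ a b c : ℤ, (q - a) * (q - b) * (q - c) =
        q ^ 3 + -q ^ 2 * a + -q ^ 2 * b + -q ^ 2 * c + q * (a * b) + q * (a * c) + q * (b * c) +
          -1 * (a * b * c) := by
      intro a b c
      ring
    simp_rw [h1, Finset.sum_add_distrib, ← Finset.mul_sum, g.sum_walshSum_triple h huv huw hvw,
      sum_walshSum_pair h σ huv, sum_walshSum_pair h σ huw, sum_walshSum_pair h σ hvw,
      sum_walshSum_shift h σ]
    simp [← hq]
    ring
  have cell : ∀ x t, (q - walshSum χ σ (u * x + t)) * (q - walshSum χ σ (v * x + t)) *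
      (q - walshSum χ σ (w * x + t)) = 8 * q ^ 3 *
        ((if x ≠ 0 ∧ u * x + t ∈ B ∧ v * x + t ∈ B ∧ w * x + t ∈ B then 1 else 0) +
          if x = 0 then (if t ∈ B then 1 else 0) else 0) := by
    intro x t
    simp only [indicator]
    rcases eq_or_ne x 0 with rfl | hx
    · simp only [mul_zero, zero_add]
      split_ifs <;> simp_all
      ring
    · split_ifs <;> simp_all
      ring
  simp_rw [cell, ← Finset.mul_sum, Finset.sum_add_distrib] at expand
  rw [← Fintype.sum_prod_type' fun x t : F =>
    if x ≠ 0 ∧ u * x + t ∈ B ∧ v * x + t ∈ B ∧ w * x + t ∈ B then (1 : ℤ) else 0,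
    Finset.sum_boole] at expand
  have hzero : ∑ x : F, ∑ t : F, (if x = 0 then (if t ∈ B then (1 : ℤ) else 0) else 0) =
      B.card := by
    rw [Finset.sum_comm]
    simp
  rw [hzero] at expand
  have hcard : 2 * (B.card : ℤ) = q := by
    rw [hq]
    exact_mod_cast two_mul_card_of_walshSum h hB
  have h3 : q ^ 3 ≠ 0 := pow_ne_zero 3 hq0
  zify
  rw [← hq]
  apply mul_left_cancel₀ h3
  linear_combination expand - 4 * q ^ 3 * hcard

theorem card_affine_blocks (g : IsTraceGen χ σ) (h : IsTraceChar χ)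
    (hB : ∀ y, walshSum χ σ y = if y ∈ B then -(Fintype.card F : ℤ) else Fintype.card F)
    {u v w : F} (huv : u ≠ v) (huw : u ≠ w) (hvw : v ≠ w) :
    8 * Nat.card {S : Set F // (∃ a b : F, a ≠ 0 ∧ S = (fun x => a * x + b) '' (B : Set F)) ∧
      u ∈ S ∧ v ∈ S ∧ w ∈ S} + 4 * Fintype.card F = Fintype.card F ^ 2 := by
  rw [_root_.card_affine_blocks, g.card_affine_triples h hB huv huw hvw]
  intro a b ha hmem
  obtain rfl := eq_one_of_affine_mem_iff (two_mul_card_of_walshSum h hB) ha hmem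
  refine ⟨rfl, g.eq_zero_of_walshSum_periodic h fun y => ?_⟩
  simp only [one_mul] at hmem
  simp only [hB, hmem]

end IsTraceGen

end TraceChar

/-- The additive character `(-1) ^ Tr x` of `GF(2^n)`. -/
noncomputable def traceChar (n : ℕ) : AddChar (GaloisField 2 n) ℤ :=
  (AddChar.zmodChar 2 (ζ := (-1 : ℤ)) (by norm_num)).compAddMonoidHom
    (Algebra.trace (ZMod 2) (GaloisField 2 n)).toAddMonoidHom

theorem traceChar_apply (n : ℕ) (x : GaloisField 2 n) :
    traceChar n x = (-1) ^ (Algebra.trace (ZMod 2) (GaloisField 2 n) x).val := rfl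

theorem isTraceChar_traceChar {n : ℕ} (hn : Odd n) : IsTraceChar (traceChar n) where
  map_sq x := by
    have := Algebra.trace_eq_of_algEquiv
      (FiniteField.frobeniusAlgEquivOfAlgebraic (ZMod 2) (GaloisField 2 n)) x
    simp only [FiniteField.coe_frobeniusAlgEquivOfAlgebraic, ZMod.card] at this
    rw [traceChar_apply, traceChar_apply, this]
  map_one := by
    have := Algebra.trace_algebraMap (S := GaloisField 2 n) (1 : ZMod 2)
    rw [map_one, GaloisField.finrank 2 hn.pos.ne', nsmul_one,
      (ZMod.natCast_eq_one_iff_odd).mpr hn] at this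
    rw [traceChar_apply, this]
    rfl

theorem IsTraceChar.map_pow_two_pow {F : Type*} [Field F] {χ : AddChar F ℤ} (h : IsTraceChar χ)
    (i : ℕ) (x : F) : χ (x ^ 2 ^ i) = χ x := by
  induction i with
  | zero => simp
  | succ i ih => rw [pow_succ, pow_mul, h.map_sq, ih]

theorem fintypeCard_galoisField {n : ℕ} (hn : n ≠ 0) : Fintype.card (GaloisField 2 n) = 2 ^ n := by
  rw [← Nat.card_eq_fintype_card, GaloisField.card 2 n hn]

theorem galoisField_pow_eq_self {n k : ℕ} (hn : n ≠ 0) (hk : k ≡ 1 [MOD 2 ^ n - 1]) (hk0 : 0 < k)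
    (x : GaloisField 2 n) : x ^ k = x := by
  rcases eq_or_ne x 0 with rfl | hx
  · exact zero_pow hk0.ne'
  · obtain ⟨t, ht⟩ := (Nat.modEq_iff_dvd' hk0).mp hk.symm
    have h1 := FiniteField.pow_card_sub_one_eq_one x hx
    rw [fintypeCard_galoisField hn] at h1
    rw [← Nat.sub_add_cancel hk0, ht, pow_succ, pow_mul, h1, one_pow, one_mul]

theorem isTraceGen_iterateFrobenius {n i e : ℕ} (hn : Odd n) (hgcd : Nat.gcd i n = 1)
    (he : (2 ^ i + 1) * e ≡ 1 [MOD 2 ^ n - 1]) (he0 : 0 < e) :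
    IsTraceGen (traceChar n) (iterateFrobeniusEquiv (GaloisField 2 n) 2 i) where
  map_char x := (isTraceChar_traceChar hn).map_pow_two_pow i x
  fixed x hx := by
    rw [iterateFrobeniusEquiv_def] at hx
    rw [or_iff_not_imp_left]
    intro hx0
    have h1 : x ^ (2 ^ i - 1) = 1 := by
      apply mul_right_cancel₀ hx0
      rw [← pow_succ, Nat.sub_add_cancel Nat.one_le_two_pow, hx, one_mul]
    have h2 := FiniteField.pow_card_sub_one_eq_one x hx0
    rw [fintypeCard_galoisField hn.pos.ne'] at h2
    have h3 := Nat.dvd_gcd (orderOf_dvd_of_pow_eq_one h1) (orderOf_dvd_of_pow_eq_one h2)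
    rw [Nat.pow_sub_one_gcd_pow_sub_one, hgcd] at h3
    exact orderOf_eq_one_iff.mp (Nat.dvd_one.mp h3)
  norm_injective x y hxy := by
    simp only [iterateFrobeniusEquiv_def, ← pow_succ'] at hxy
    have h1 := congrArg (· ^ e) hxy
    simp only [← pow_mul] at h1
    rwa [galoisField_pow_eq_self hn.pos.ne' he (by positivity),
      galoisField_pow_eq_self hn.pos.ne' he (by positivity)] at h1

/-- Theorem 4.2: for odd `n` and `gcd(i,n) = 1`, the base block
`B = GF(q) ∖ {((x+1)^s + x^s + 1)^{1/(2^i+1)} : x ∈ GF(q)}` with `s = 2^{2i} - 2^i + 1`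
supports a `3-(q, q/2, q(q-4)/8)` design. -/
theorem stmt_11 (n i s e : ℕ) (hn : Odd n) (hi : 0 < i) (hgcd : Nat.gcd i n = 1)
    (hs : s = 2 ^ (2 * i) - 2 ^ i + 1) (he : (2 ^ i + 1) * e ≡ 1 [MOD 2 ^ n - 1])
    (he0 : 0 < e) (B : Set (GaloisField 2 n))
    (hB : B = Set.univ \
      {y : GaloisField 2 n | ∃ x : GaloisField 2 n, y = ((x + 1) ^ s + x ^ s + 1) ^ e}) :
    B.ncard = 2 ^ n / 2 ∧
    (∀ S ∈ affOrbit B, S.ncard = 2 ^ n / 2) ∧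
    ∀ u v w : GaloisField 2 n, u ≠ v → u ≠ w → v ≠ w →
      Nat.card {S : Set (GaloisField 2 n) // S ∈ affOrbit B ∧ u ∈ S ∧ v ∈ S ∧ w ∈ S}
        = 2 ^ n * (2 ^ n - 4) / 8 := by
  classical
  have hn0 : n ≠ 0 := hn.pos.ne'
  have hcard := fintypeCard_galoisField hn0
  have h := isTraceChar_traceChar hn
  have g := isTraceGen_iterateFrobenius hn hgcd he he0
  lift B to Finset (GaloisField 2 n) using B.toFinite
  have hs0 : s ≠ 0 := by omega
  have hsi : s + 2 ^ i = 1 + 2 ^ i * 2 ^ i := by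
    have h1 : 2 ^ i ≤ 2 ^ (2 * i) := Nat.pow_le_pow_right (by norm_num) (by omega)
    rw [hs, ← pow_add, ← two_mul]
    omega
  have hroot : ∀ y z : GaloisField 2 n, y * y ^ 2 ^ i = z ↔ y = z ^ e := by
    intro y z
    rw [← pow_succ']
    constructor
    · rintro rfl
      rw [← pow_mul, galoisField_pow_eq_self hn0 he (by positivity)]
    · rintro rfl
      rw [← pow_mul, mul_comm, galoisField_pow_eq_self hn0 he (by positivity)]
  have hwalsh : ∀ y, walshSum (traceChar n) (iterateFrobeniusEquiv (GaloisField 2 n) 2 i) y =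
      if y ∈ B then -(Fintype.card (GaloisField 2 n) : ℤ)
      else Fintype.card (GaloisField 2 n) := by
    intro y
    have hy : y ∈ B ↔ ¬∃ x : GaloisField 2 n, y = ((x + 1) ^ s + x ^ s + 1) ^ e := by
      rw [← Finset.mem_coe, hB]
      simp
    have hP : ∀ x : GaloisField 2 n, x ^ s * x ^ 2 ^ i = x * (x ^ 2 ^ i) ^ 2 ^ i := by
      intro x
      rw [← pow_mul, ← pow_succ', ← pow_add, hsi, add_comm]
    have hparam := g.exists_param_iff h (P := fun x => x ^ s) hP (zero_pow hs0) y
    simp only [iterateFrobeniusEquiv_def, hroot] at hparam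
    rw [← not_iff_not, ← hy] at hparam
    rw [g.walshSum_eq h, ← ite_not]
    simp only [iterateFrobeniusEquiv_def, hparam]
  have hhalf : B.card = 2 ^ n / 2 := by
    have := IsTraceGen.two_mul_card_of_walshSum h hwalsh
    omega
  refine ⟨by rw [Set.ncard_coe_finset, hhalf], ?_, ?_⟩
  · rintro S ⟨a, b, ha, rfl⟩
    rw [Set.ncard_image_of_injective _ fun x y hxy =>
      mul_left_cancel₀ ha (add_right_cancel hxy), Set.ncard_coe_finset, hhalf]
  · intro u v w huv huw hvw
    have hblocks := g.card_affine_blocks h hwalsh huv huw hvw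
    rw [hcard, sq] at hblocks
    have hmul : 2 ^ n * (2 ^ n - 4) = 2 ^ n * 2 ^ n - 2 ^ n * 4 := Nat.mul_sub _ _ _
    change Nat.card {S : Set (GaloisField 2 n) // (∃ a b : GaloisField 2 n, a ≠ 0 ∧
      S = (fun x => a * x + b) '' (B : Set (GaloisField 2 n))) ∧ u ∈ S ∧ v ∈ S ∧ w ∈ S} = _
    omega
end
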